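/- Let B be an even simple Bratteli diagram with full group G=G_B and path space X=X_B, and suppose (X,G) admits exactly k ergodic G-invariant Borel probability measures μ_1,…,μ_k (1≤k<∞). Let φ be an atomless ergodic invariant random subgroup of G admitting nonnegative reals c_∞ and c_α (α∈Z_{≥0}^k) with c_∞+Σ_α c_α=1 such that φ(Fix_{Sub(G)}(g)) = c_∞·1_{g=e} + Σ_α c_α·μ_α(Fix_{X^{|α|}}(g)) for every g∈G, and suppose some c_α>0; let r=min{|β| : c_β>0} and fix β_0 with |β_0|=r and c_{β_0}>0. Let {Ξ_n} be a nested sequence of finite clopen partitions of X with mesh tending to 0 and let N be such that for all p≤r, n≥N and all C̄,D̄∈Ξ_{p,n} one has (∪C̄)∪(∪D̄)≠X. Then for every n≥N: φ(⋃_{C̄∈Ξ_{r,n}} F(∪C̄)) ≥ c_{β_0} > 0. -/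

import Mathlib

open MeasureTheory Filter
open scoped ENNReal ComplexOrder

noncomputable section

/-- A Bratteli diagram: vertex levels `V i`, edge levels `E i` (edges from `V i` to `V (i+1)`),
all levels finite and nonempty, a single root vertex, and source/range maps that are
surjective (every vertex emits and receives an edge). -/
structure BratteliDiagram where
  V : ℕ → Type
  E : ℕ → Type
  fintypeV : ∀ i, Fintype (V i)
  fintypeE : ∀ i, Fintype (E i)
  nonemptyV : ∀ i, Nonempty (V i)
  nonemptyE : ∀ i, Nonempty (E i)
  subsingleton_root : Subsingleton (V 0)
  src : ∀ i, E i → V i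
  rng : ∀ i, E i → V (i + 1)
  src_surj : ∀ i, Function.Surjective (src i)
  rng_surj : ∀ i, Function.Surjective (rng i)

namespace BratteliDiagram

variable (B : BratteliDiagram)

/-- The path space `X_B`: infinite paths starting at the root. -/
def Path : Type :=
  { x : ∀ i, B.E i // ∀ i, B.rng i (x i) = B.src (i + 1) (x (i + 1)) }

instance (i : ℕ) : UniformSpace (B.E i) := ⊥

instance instUniformSpacePath : UniformSpace B.Path :=
  inferInstanceAs (UniformSpace { x : ∀ i, B.E i // ∀ i, B.rng i (x i) = B.src (i + 1) (x (i + 1)) })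

instance instMeasurableSpacePath : MeasurableSpace B.Path := borel _

/-- Finite segments of `L+1` consecutive edges starting at level `n`. -/
def Seg (n L : ℕ) : Type :=
  { f : ∀ i : Fin (L + 1), B.E (n + (i : ℕ)) //
    ∀ (i : ℕ) (hi : i < L),
      B.rng (n + i) (f ⟨i, by omega⟩) = B.src (n + (i + 1)) (f ⟨i + 1, by omega⟩) }

/-- The number of finite paths connecting `v ∈ V n` to `w ∈ V (n + L + 1)`. -/
def numPaths (n L : ℕ) (v : B.V n) (w : B.V (n + L + 1)) : ℕ :=
  Nat.card { f : B.Seg n L //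
    B.src n (f.1 ⟨0, by omega⟩) = v ∧ B.rng (n + L) (f.1 ⟨L, by omega⟩) = w }

/-- A Bratteli diagram is simple if every vertex of a given level is connected
to every vertex of some deeper level. -/
def IsSimple : Prop :=
  ∀ n : ℕ, ∃ L : ℕ, ∀ (v : B.V n) (w : B.V (n + L + 1)), 0 < B.numPaths n L v w

/-- A Bratteli diagram is even if every vertex of a given level is connected to every
vertex of some deeper level by a (positive) even number of paths. -/
def IsEven : Prop :=
  ∀ n : ℕ, ∃ L : ℕ, ∀ (v : B.V n) (w : B.V (n + L + 1)),
    0 < B.numPaths n L v w ∧ Even (B.numPaths n L v w)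

/-- A permutation of the path space "of level `n`": it changes only the first `n` edges,
and what it does to the first `n` edges depends only on the first `n` edges. -/
def IsLevel (n : ℕ) (g : Equiv.Perm B.Path) : Prop :=
  (∀ (x : B.Path) (i : ℕ), n ≤ i → (g x).1 i = x.1 i) ∧
  (∀ x y : B.Path, (∀ i : ℕ, i < n → x.1 i = y.1 i) → ∀ i : ℕ, i < n → (g x).1 i = (g y).1 i)

theorem isLevel_one (n : ℕ) : B.IsLevel n 1 :=
  ⟨fun _ _ _ => rfl, fun _ _ h i hi => h i hi⟩

theorem IsLevel.mul {n : ℕ} {a b : Equiv.Perm B.Path} (ha : B.IsLevel n a)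
    (hb : B.IsLevel n b) : B.IsLevel n (a * b) := by
  constructor
  · intro x i hi
    have h1 := ha.1 (b x) i hi
    have h2 := hb.1 x i hi
    simpa [Equiv.Perm.mul_apply] using h1.trans h2
  · intro x y hxy i hi
    have h2 := hb.2 x y hxy
    have := ha.2 (b x) (b y) h2 i hi
    simpa [Equiv.Perm.mul_apply] using this

theorem IsLevel.mono {n m : ℕ} (hnm : n ≤ m) {g : Equiv.Perm B.Path}
    (h : B.IsLevel n g) : B.IsLevel m g := by
  refine ⟨fun x i hi => h.1 x i (hnm.trans hi), fun x y hxy i hi => ?_⟩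
  rcases lt_or_ge i n with h' | h'
  · exact h.2 x y (fun j hj => hxy j (hj.trans_le hnm)) i h'
  · rw [h.1 x i h', h.1 y i h']
    exact hxy i hi

/-- The group `G_n` of homeomorphisms of the path space permuting only the
first `n` edges of infinite paths. -/
def level (n : ℕ) : Subgroup (Equiv.Perm B.Path) where
  carrier := { g | B.IsLevel n g ∧ B.IsLevel n g⁻¹ }
  one_mem' := ⟨B.isLevel_one n, by simpa using B.isLevel_one n⟩
  mul_mem' := by
    intro a b ha hb
    exact ⟨ha.1.mul B hb.1, by rw [mul_inv_rev]; exact IsLevel.mul B hb.2 ha.2⟩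
  inv_mem' := by
    intro a ha
    exact ⟨ha.2, by simpa using ha.1⟩

theorem level_mono {n m : ℕ} (h : n ≤ m) : B.level n ≤ B.level m := by
  intro g hg
  exact ⟨hg.1.mono B h, hg.2.mono B h⟩

/-- The full group `G_B = ⋃ n, G_n` of the Bratteli diagram. -/
def fullGroup : Subgroup (Equiv.Perm B.Path) where
  carrier := { g | ∃ n, g ∈ B.level n }
  one_mem' := ⟨0, one_mem _⟩
  mul_mem' := by
    rintro a b ⟨n, ha⟩ ⟨m, hb⟩
    exact ⟨max n m, mul_mem (B.level_mono (le_max_left n m) ha)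
      (B.level_mono (le_max_right n m) hb)⟩
  inv_mem' := by
    rintro a ⟨n, ha⟩
    exact ⟨n, inv_mem ha⟩

/-- `G_n` viewed as a subgroup of the full group. -/
def levelIn (n : ℕ) : Subgroup ↥B.fullGroup := (B.level n).comap B.fullGroup.subtype

/-- The subgroup `G°(A)` of elements of the full group fixing `A` pointwise. -/
def Gcirc (A : Set B.Path) : Subgroup ↥B.fullGroup :=
  ⨅ x ∈ A, MulAction.stabilizer ↥B.fullGroup x

/-- `G°_n(A) = G_n ∩ G°(A)`. -/
def GcircN (n : ℕ) (A : Set B.Path) : Subgroup ↥B.fullGroup :=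
  B.levelIn n ⊓ B.Gcirc A

end BratteliDiagram

/-- Conjugation of a subgroup: `g • H = gHg⁻¹`. -/
def conjSub {Γ : Type*} [Group Γ] (g : Γ) (H : Subgroup Γ) : Subgroup Γ :=
  Subgroup.map (MulAut.conj g).toMonoidHom H

/-- The Borel structure on the space `Sub(Γ)` of subgroups of `Γ`,
induced from the product space `{0,1}^Γ` (equivalently `Set Γ`). -/
instance subgroupMeasurableSpace {Γ : Type*} [Group Γ] : MeasurableSpace (Subgroup Γ) :=
  MeasurableSpace.comap (fun H => (H : Set Γ)) inferInstance

namespace BratteliDiagram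

variable (B : BratteliDiagram)

/-- `F(A)`: the collection of subgroups of the full group normalized by `G°(A)`. -/
def FF (A : Set B.Path) : Set (Subgroup ↥B.fullGroup) :=
  { H | ∀ g ∈ B.Gcirc A, conjSub g H = H }

end BratteliDiagram

/-- A measure `ν` on `Y` is invariant under the action of `G`. -/
def MeasInv (G : Type*) [Group G] {Y : Type*} [MeasurableSpace Y] [MulAction G Y]
    (ν : Measure Y) : Prop :=
  ∀ (g : G) (s : Set Y), MeasurableSet s → ν ((fun y => g • y) ⁻¹' s) = ν s

/-- The action of `G` on `(Y, ν)` is ergodic: every invariant measurable set is null or conull. -/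
def MeasErg (G : Type*) [Group G] {Y : Type*} [MeasurableSpace Y] [MulAction G Y]
    (ν : Measure Y) : Prop :=
  ∀ s : Set Y, MeasurableSet s → (∀ g : G, (fun y => g • y) ⁻¹' s = s) → ν s = 0 ∨ ν s = 1

/-- An invariant random subgroup: a conjugation-invariant Borel probability measure on `Sub(G)`. -/
def IsIRS (G : Type*) [Group G] (φ : Measure (Subgroup G)) : Prop :=
  IsProbabilityMeasure φ ∧
    ∀ (g : G) (s : Set (Subgroup G)), MeasurableSet s → φ (conjSub g ⁻¹' s) = φ s

/-- An ergodic invariant random subgroup. -/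
def IsErgodicIRS (G : Type*) [Group G] (φ : Measure (Subgroup G)) : Prop :=
  IsIRS G φ ∧
    ∀ s : Set (Subgroup G), MeasurableSet s → (∀ g : G, conjSub g ⁻¹' s = s) →
      φ s = 0 ∨ φ s = 1

/-- A character of a group: normalized, central, positive semidefinite complex function. -/
def IsCharacter (G : Type*) [Group G] (χ : G → ℂ) : Prop :=
  χ 1 = 1 ∧ (∀ a b : G, χ (a * b) = χ (b * a)) ∧
    ∀ (n : ℕ) (g : Fin n → G) (c : Fin n → ℂ),
      0 ≤ ∑ i, ∑ j, (starRingEnd ℂ) (c i) * c j * χ (g i * (g j)⁻¹)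

namespace BratteliDiagram

variable (B : BratteliDiagram)

/-- The product measure `μ_α = μ_1^{α_1} × ⋯ × μ_k^{α_k}` on `X^{|α|}`,
realized on the index type `Σ i : Fin k, Fin (α i)` (of cardinality `|α| = Σ α i`). -/
def prodMeasure {k : ℕ} (μ : Fin k → Measure B.Path) (α : Fin k → ℕ) :
    Measure ((Σ i : Fin k, Fin (α i)) → B.Path) :=
  Measure.pi fun p => μ p.1

/-- The stabilizer distribution `φ_α` of the diagonal action of the full group
on `(X^{|α|}, μ_α)`. -/
def stabDist {k : ℕ} (μ : Fin k → Measure B.Path) (α : Fin k → ℕ) :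
    Measure (Subgroup ↥B.fullGroup) :=
  Measure.map (fun y => MulAction.stabilizer ↥B.fullGroup y) (B.prodMeasure μ α)

end BratteliDiagram

namespace BratteliDiagram

variable {B : BratteliDiagram}

theorem path_ext {x y : B.Path} (h : ∀ i, x.1 i = y.1 i) : x = y := Subtype.ext (funext h)

/-- the vertex of level `m` on the path `x` -/
def vtx (m : ℕ) (x : B.Path) : B.V m := B.src m (x.1 m)

/-- agreement of the first `m` edges -/
def eqv (m : ℕ) (x y : B.Path) : Prop := ∀ i < m, x.1 i = y.1 i

theorem eqv.refl (m : ℕ) (x : B.Path) : eqv m x x := fun _ _ => rfl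
theorem eqv.symm {m : ℕ} {x y : B.Path} (h : eqv m x y) : eqv m y x := fun i hi => (h i hi).symm
theorem eqv.trans {m : ℕ} {x y z : B.Path} (h : eqv m x y) (h' : eqv m y z) : eqv m x z :=
  fun i hi => (h i hi).trans (h' i hi)
theorem eqv.mono {m m' : ℕ} (hm : m ≤ m') {x y : B.Path} (h : eqv m' x y) : eqv m x y :=
  fun i hi => h i (hi.trans_le hm)

theorem eqv.vtx {m : ℕ} {x y : B.Path} (h : eqv m x y) : vtx m x = vtx m y := by
  cases m with
  | zero => exact B.subsingleton_root.elim _ _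
  | succ k =>
    unfold BratteliDiagram.vtx
    rw [← x.2 k, ← y.2 k, h k (Nat.lt_succ_self k)]

/-- first `m` edges of `x`, then the tail of `z` -/
def spl (m : ℕ) (x z : B.Path) (h : vtx m x = vtx m z) : B.Path :=
    ⟨fun i => if i < m then x.1 i else z.1 i, by
      intro i
      rcases lt_trichotomy (i + 1) m with h1 | h1 | h1
      · have h2 : i < m := by omega
        simp only [h1, h2, if_true]
        exact x.2 i
      · subst h1
        have h2 : ¬ (i + 1 < i + 1) := by omega
        have h3 : i < i + 1 := by omega
        simp only [h2, h3, if_true, if_false]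
        rw [x.2 i]
        exact h
      · have h2 : ¬ i < m := by omega
        have h3 : ¬ i + 1 < m := by omega
        simp only [h2, h3, if_false]
        exact z.2 i⟩

theorem spl_val (m : ℕ) (x z : B.Path) (h : vtx m x = vtx m z) (i : ℕ) :
    (spl m x z h).1 i = if i < m then x.1 i else z.1 i := rfl

open Classical in
/-- first `m` edges of `x`, then the tail of `z` -/
def splice (m : ℕ) (x z : B.Path) : B.Path :=
  if h : vtx m x = vtx m z then spl m x z h else z

theorem splice_pos {m : ℕ} {x z : B.Path} (h : vtx m x = vtx m z) :
    splice m x z = spl m x z h := dif_pos h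

theorem splice_neg {m : ℕ} {x z : B.Path} (h : ¬ vtx m x = vtx m z) :
    splice m x z = z := dif_neg h

theorem splice_lt {m : ℕ} {x z : B.Path} (h : vtx m x = vtx m z) {i : ℕ} (hi : i < m) :
    (splice m x z).1 i = x.1 i := by
  rw [splice_pos h, spl_val, if_pos hi]

theorem splice_ge {m : ℕ} (x z : B.Path) {i : ℕ} (hi : m ≤ i) :
    (splice m x z).1 i = z.1 i := by
  by_cases h : vtx m x = vtx m z
  · rw [splice_pos h, spl_val, if_neg (by omega)]
  · rw [splice_neg h]

theorem splice_eqv {m : ℕ} {x z : B.Path} (h : vtx m x = vtx m z) : eqv m (splice m x z) x :=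
  fun _ hi => splice_lt h hi

open Classical in
/-- swap of the two prefixes of `x` and `y`, on tails from `D`, as a function -/
def swf (m : ℕ) (x y : B.Path) (D : Set B.Path) (z : B.Path) : B.Path :=
  if z ∈ D ∧ eqv m z x then splice m y z
  else if z ∈ D ∧ eqv m z y then splice m x z else z

/-- membership depends only on the tail -/
def TI (m : ℕ) (D : Set B.Path) : Prop :=
  ∀ z z' : B.Path, (∀ i, m ≤ i → z.1 i = z'.1 i) → z ∈ D → z' ∈ D

/-- membership depends only on the first `m` edges -/
def Dep (m : ℕ) (D : Set B.Path) : Prop :=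
  ∀ z z' : B.Path, eqv m z z' → z ∈ D → z' ∈ D

theorem Dep.mono {m m' : ℕ} (hm : m ≤ m') {D : Set B.Path} (h : Dep m D) : Dep m' D :=
  fun z z' hz => h z z' (hz.mono hm)

theorem TI_univ (m : ℕ) : TI m (Set.univ : Set B.Path) := fun _ _ _ _ => trivial
theorem Dep_univ (m : ℕ) : Dep m (Set.univ : Set B.Path) := fun _ _ _ _ => trivial

theorem swf_ge (m : ℕ) (x y : B.Path) (D : Set B.Path) (z : B.Path) {i : ℕ} (hi : m ≤ i) :
    (swf m x y D z).1 i = z.1 i := by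
  unfold swf
  split_ifs
  · exact splice_ge _ _ hi
  · exact splice_ge _ _ hi
  · rfl

theorem swf_x {m : ℕ} {x y : B.Path} {D : Set B.Path} {z : B.Path} (hz : z ∈ D)
    (h : eqv m z x) : swf m x y D z = splice m y z := by
  unfold swf; rw [if_pos ⟨hz, h⟩]

theorem swf_y {m : ℕ} {x y : B.Path} (hxy : vtx m x = vtx m y) {D : Set B.Path} {z : B.Path}
    (hz : z ∈ D) (h : eqv m z y) : swf m x y D z = splice m x z := by
  by_cases h' : eqv m z x
  · rw [swf_x hz h']
    apply path_ext
    intro i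
    rcases lt_or_ge i m with hi | hi
    · rw [splice_lt (h.vtx.symm) hi, splice_lt (h'.vtx.symm) hi, ← h i hi, h' i hi]
    · rw [splice_ge _ _ hi, splice_ge _ _ hi]
  · unfold swf; rw [if_neg (fun hh => h' hh.2), if_pos ⟨hz, h⟩]

theorem swf_fix {m : ℕ} {x y : B.Path} {D : Set B.Path} {z : B.Path}
    (h : z ∉ D ∨ (¬ eqv m z x ∧ ¬ eqv m z y)) : swf m x y D z = z := by
  unfold swf
  rw [if_neg (by tauto), if_neg (by tauto)]

theorem splice_splice {m : ℕ} {x y z : B.Path} (h : eqv m z x) (hxy : vtx m x = vtx m y) :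
    splice m x (splice m y z) = z := by
  have h1 : vtx m y = vtx m z := hxy.symm.trans h.vtx.symm
  have h2 : vtx m (splice m y z) = vtx m y := (splice_eqv h1).vtx
  apply path_ext
  intro i
  rcases lt_or_ge i m with hi | hi
  · rw [splice_lt (hxy.trans h2.symm) hi, h i hi]
  · rw [splice_ge _ _ hi, splice_ge _ _ hi]

theorem swf_invol {m : ℕ} {x y : B.Path} (hxy : vtx m x = vtx m y) {D : Set B.Path}
    (hD : TI m D) : Function.Involutive (swf m x y D) := by
  intro z
  have hD' : ∀ u, z ∈ D → splice m u z ∈ D := fun u hz =>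
    hD z _ (fun i hi => (splice_ge u z hi).symm) hz
  by_cases h : z ∈ D ∧ eqv m z x
  · rw [swf_x h.1 h.2, swf_y hxy (hD' _ h.1)
      (splice_eqv (hxy.symm.trans h.2.vtx.symm)), splice_splice h.2 hxy]
  · by_cases h' : z ∈ D ∧ eqv m z y
    · rw [swf_y hxy h'.1 h'.2, swf_x (hD' _ h'.1)
        (splice_eqv (hxy.trans h'.2.vtx.symm)), splice_splice h'.2 hxy.symm]
    · have : swf m x y D z = z := swf_fix (by tauto)
      rw [this, this]

open Classical in
/-- the swap as a permutation -/
def sw (m : ℕ) (x y : B.Path) (D : Set B.Path) : Equiv.Perm B.Path :=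
  if h : Function.Involutive (swf m x y D) then h.toPerm else 1

theorem sw_apply {m : ℕ} {x y : B.Path} (hxy : vtx m x = vtx m y) {D : Set B.Path}
    (hD : TI m D) (z : B.Path) : sw m x y D z = swf m x y D z := by
  unfold sw
  rw [dif_pos (swf_invol hxy hD)]
  rfl

theorem sw_mul_self {m : ℕ} {x y : B.Path} (hxy : vtx m x = vtx m y) {D : Set B.Path}
    (hD : TI m D) : sw m x y D * sw m x y D = 1 := by
  ext1 z
  rw [Equiv.Perm.mul_apply, sw_apply hxy hD, sw_apply hxy hD, swf_invol hxy hD z]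
  rfl

theorem sw_inv {m : ℕ} {x y : B.Path} (hxy : vtx m x = vtx m y) {D : Set B.Path}
    (hD : TI m D) : (sw m x y D)⁻¹ = sw m x y D :=
  inv_eq_of_mul_eq_one_left (sw_mul_self hxy hD)

theorem sw_level {m m' : ℕ} (hm : m ≤ m') {x y : B.Path} (hxy : vtx m x = vtx m y)
    {D : Set B.Path} (hD : TI m D) (hD' : Dep m' D) : sw m x y D ∈ B.level m' := by
  have : B.IsLevel m' (sw m x y D) := by
    refine ⟨fun z i hi => ?_, fun z z' hz i hi => ?_⟩
    · rw [sw_apply hxy hD, swf_ge _ _ _ _ _ (hm.trans hi)]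
    · rw [sw_apply hxy hD, sw_apply hxy hD]
      have hz' : eqv m' z z' := hz
      have hzm : eqv m z z' := hz'.mono hm
      rcases le_or_gt m i with hmi | hmi
      · rw [swf_ge _ _ _ _ _ hmi, swf_ge _ _ _ _ _ hmi, hz i hi]
      · by_cases hzD : z ∈ D
        · have hzD' := hD' z z' hz' hzD
          by_cases h1 : eqv m z x
          · rw [swf_x hzD h1, swf_x hzD' (hzm.symm.trans h1),
              splice_lt (hxy.symm.trans h1.vtx.symm) hmi,
              splice_lt (hxy.symm.trans (hzm.symm.trans h1).vtx.symm) hmi]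
          · by_cases h2 : eqv m z y
            · rw [swf_y hxy hzD h2, swf_y hxy hzD' (hzm.symm.trans h2),
                splice_lt (hxy.trans h2.vtx.symm) hmi,
                splice_lt (hxy.trans (hzm.symm.trans h2).vtx.symm) hmi]
            · rw [swf_fix (Or.inr ⟨h1, h2⟩),
                swf_fix (Or.inr ⟨fun h => h1 (hzm.trans h), fun h => h2 (hzm.trans h)⟩), hz i hi]
        · have hzD' : z' ∉ D := fun h => hzD (hD' z' z hz'.symm h)
          rw [swf_fix (Or.inl hzD), swf_fix (Or.inl hzD'), hz i hi]
  exact ⟨this, by rw [sw_inv hxy hD]; exact this⟩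

/-- `G°(A)` as a subgroup of all permutations -/
def KK (A : Set B.Path) : Subgroup (Equiv.Perm B.Path) where
  carrier := { g | (∃ n, g ∈ B.level n) ∧ ∀ x ∈ A, g x = x }
  one_mem' := ⟨⟨0, one_mem _⟩, fun _ _ => rfl⟩
  mul_mem' := by
    intro a b ha hb
    refine ⟨B.fullGroup.mul_mem ha.1 hb.1, fun x hx => ?_⟩
    rw [Equiv.Perm.mul_apply, hb.2 x hx, ha.2 x hx]
  inv_mem' := by
    intro a ha
    refine ⟨B.fullGroup.inv_mem ha.1, fun x hx => ?_⟩
    rw [Equiv.Perm.inv_eq_iff_eq, ha.2 x hx]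

theorem sw_fixes {m : ℕ} {x y : B.Path} (hxy : vtx m x = vtx m y)
    {D : Set B.Path} (hD : TI m D) {A : Set B.Path} (hA : Dep m A)
    (hx : x ∉ A) (hy : y ∉ A) : ∀ z ∈ A, sw m x y D z = z := by
  intro z hz
  rw [sw_apply hxy hD]
  exact swf_fix (Or.inr ⟨fun h => hx (hA _ _ h hz), fun h => hy (hA _ _ h hz)⟩)

theorem sw_mem_KK {m m' : ℕ} (hm : m ≤ m') {x y : B.Path} (hxy : vtx m x = vtx m y)
    {D : Set B.Path} (hD : TI m D) (hD' : Dep m' D) {A : Set B.Path} (hA : Dep m A)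
    (hx : x ∉ A) (hy : y ∉ A) : sw m x y D ∈ KK A :=
  ⟨⟨m', sw_level hm hxy hD hD'⟩, sw_fixes hxy hD hA hx hy⟩

/-- plain swap of two prefixes -/
def ss (m : ℕ) (x y : B.Path) : Equiv.Perm B.Path := sw m x y Set.univ

theorem ss_mem_KK {m : ℕ} {x y : B.Path} (hxy : vtx m x = vtx m y) {A : Set B.Path}
    (hA : Dep m A) (hx : x ∉ A) (hy : y ∉ A) : ss m x y ∈ KK A :=
  sw_mem_KK le_rfl hxy (TI_univ m) (Dep_univ m) hA hx hy

theorem ss_level {m : ℕ} {x y : B.Path} (hxy : vtx m x = vtx m y) : ss m x y ∈ B.level m :=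
  sw_level le_rfl hxy (TI_univ m) (Dep_univ m)

theorem ss_x {m : ℕ} {x y z : B.Path} (hxy : vtx m x = vtx m y) (h : eqv m z x) :
    eqv m (ss m x y z) y := by
  unfold ss
  rw [sw_apply hxy (TI_univ m), swf_x (Set.mem_univ _) h]
  exact splice_eqv (hxy.symm.trans h.vtx.symm)

theorem ss_y {m : ℕ} {x y z : B.Path} (hxy : vtx m x = vtx m y) (h : eqv m z y) :
    eqv m (ss m x y z) x := by
  unfold ss
  rw [sw_apply hxy (TI_univ m), swf_y hxy (Set.mem_univ _) h]
  exact splice_eqv (hxy.trans h.vtx.symm)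

theorem ss_ne {m : ℕ} {x y z : B.Path} (hxy : vtx m x = vtx m y) (h : ¬ eqv m z x)
    (h' : ¬ eqv m z y) : ss m x y z = z := by
  unfold ss
  rw [sw_apply hxy (TI_univ m), swf_fix (Or.inr ⟨h, h'⟩)]

theorem level_eqv {m : ℕ} {g : Equiv.Perm B.Path} (hg : g ∈ B.level m) {x y : B.Path} :
    eqv m (g x) (g y) ↔ eqv m x y := by
  constructor
  · intro h
    have := hg.2.2 (g x) (g y) h
    intro i hi
    have h2 := this i hi
    have e : ∀ u : B.Path, g⁻¹ (g u) = u := fun u => g.symm_apply_apply u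
    rwa [e, e] at h2
  · intro h
    exact hg.1.2 x y h

theorem level_vtx {m : ℕ} {g : Equiv.Perm B.Path} (hg : g ∈ B.level m) (x : B.Path) :
    vtx m (g x) = vtx m x := by
  unfold vtx
  rw [hg.1.1 x m le_rfl]

theorem level_splice {m : ℕ} {g : Equiv.Perm B.Path} (hg : g ∈ B.level m) {y z : B.Path}
    (h : vtx m y = vtx m z) : g (splice m y z) = splice m (g y) (g z) := by
  apply path_ext
  intro i
  rcases lt_or_ge i m with hi | hi
  · rw [splice_lt (by rw [level_vtx hg, level_vtx hg, h]) hi]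
    exact (level_eqv hg).2 (splice_eqv h) i hi
  · rw [splice_ge _ _ hi, hg.1.1 _ i hi, hg.1.1 _ i hi, splice_ge _ _ hi]

theorem ss_conj {m : ℕ} {g : Equiv.Perm B.Path} (hg : g ∈ B.level m) {x y : B.Path}
    (hxy : vtx m x = vtx m y) : g * ss m x y * g⁻¹ = ss m (g x) (g y) := by
  have hxy' : vtx m (g x) = vtx m (g y) := by rw [level_vtx hg, level_vtx hg, hxy]
  rw [mul_inv_eq_iff_eq_mul]
  ext1 z
  rw [Equiv.Perm.mul_apply, Equiv.Perm.mul_apply]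
  unfold ss
  rw [sw_apply hxy (TI_univ m), sw_apply hxy' (TI_univ m)]
  by_cases h1 : eqv m z x
  · rw [swf_x (Set.mem_univ _) h1, swf_x (Set.mem_univ _) ((level_eqv hg).2 h1),
      level_splice hg (hxy.symm.trans h1.vtx.symm)]
  · by_cases h2 : eqv m z y
    · rw [swf_y hxy (Set.mem_univ _) h2, swf_y hxy' (Set.mem_univ _) ((level_eqv hg).2 h2),
        level_splice hg (hxy.trans h2.vtx.symm)]
    · rw [swf_fix (Or.inr ⟨h1, h2⟩), swf_fix (Or.inr ⟨fun h => h1 ((level_eqv hg).1 h),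
        fun h => h2 ((level_eqv hg).1 h)⟩)]

theorem sw_congr_xy {m : ℕ} {x y x' y' : B.Path} {D : Set B.Path} (hD : TI m D)
    (hxy : vtx m x = vtx m y) (hx : eqv m x x') (hy : eqv m y y') :
    sw m x y D = sw m x' y' D := by
  have hxy' : vtx m x' = vtx m y' := by rw [← hx.vtx, ← hy.vtx, hxy]
  ext1 z
  rw [sw_apply hxy hD, sw_apply hxy' hD]
  have key : ∀ u v : B.Path, eqv m u v → splice m u z = splice m v z := by
    intro u v huv
    by_cases h : vtx m u = vtx m z
    · have h' := huv.vtx.symm.trans h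
      apply path_ext
      intro i
      rcases lt_or_ge i m with hi | hi
      · rw [splice_lt h hi, splice_lt h' hi, huv i hi]
      · rw [splice_ge _ _ hi, splice_ge _ _ hi]
    · rw [splice_neg h, splice_neg (fun h' => h (huv.vtx.trans h'))]
  by_cases hz : z ∈ D
  · by_cases h1 : eqv m z x
    · rw [swf_x hz h1, swf_x hz (h1.trans hx), key y y' hy]
    · by_cases h2 : eqv m z y
      · rw [swf_y hxy hz h2, swf_y hxy' hz (h2.trans hy), key x x' hx]
      · rw [swf_fix (Or.inr ⟨h1, h2⟩), swf_fix (Or.inr ⟨fun h => h1 (h.trans hx.symm),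
          fun h => h2 (h.trans hy.symm)⟩)]
  · rw [swf_fix (Or.inl hz), swf_fix (Or.inl hz)]

theorem ss_congr {m : ℕ} {x y x' y' : B.Path}
    (hxy : vtx m x = vtx m y) (hx : eqv m x x') (hy : eqv m y y') :
    ss m x y = ss m x' y' := sw_congr_xy (TI_univ m) hxy hx hy

theorem ss_comm {m : ℕ} {x y : B.Path} (hxy : vtx m x = vtx m y) : ss m x y = ss m y x := by
  ext1 z
  unfold ss
  rw [sw_apply hxy (TI_univ m), sw_apply hxy.symm (TI_univ m)]
  by_cases h1 : eqv m z x
  · rw [swf_x (Set.mem_univ _) h1, swf_y hxy.symm (Set.mem_univ _) h1]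
  · by_cases h2 : eqv m z y
    · rw [swf_y hxy (Set.mem_univ _) h2, swf_x (Set.mem_univ _) h2]
    · rw [swf_fix (Or.inr ⟨h1, h2⟩), swf_fix (Or.inr ⟨h2, h1⟩)]

theorem sw_self {m : ℕ} {x y : B.Path} (h : eqv m x y) {D : Set B.Path} (hD : TI m D) :
    sw m x y D = 1 := by
  ext1 z
  rw [sw_apply h.vtx hD, Equiv.Perm.one_apply]
  by_cases hz : z ∈ D
  · by_cases h1 : eqv m z x
    · rw [swf_x hz h1]
      apply path_ext
      intro i
      rcases lt_or_ge i m with hi | hi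
      · rw [splice_lt (h1.trans h).vtx.symm hi, (h1.trans h) i hi]
      · rw [splice_ge _ _ hi]
    · exact swf_fix (Or.inr ⟨h1, fun h2 => h1 (h2.trans h.symm)⟩)
  · exact swf_fix (Or.inl hz)

theorem sw_congr_D {m : ℕ} {x y : B.Path} (hxy : vtx m x = vtx m y) {D D' : Set B.Path}
    (hD : TI m D) (hD' : TI m D') (h : ∀ z, vtx m z = vtx m x → (z ∈ D ↔ z ∈ D')) :
    sw m x y D = sw m x y D' := by
  ext1 z
  rw [sw_apply hxy hD, sw_apply hxy hD']
  by_cases h1 : eqv m z x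
  · have := h z h1.vtx
    by_cases hz : z ∈ D
    · rw [swf_x hz h1, swf_x (this.1 hz) h1]
    · rw [swf_fix (Or.inl hz), swf_fix (Or.inl (fun hh => hz (this.2 hh)))]
  · by_cases h2 : eqv m z y
    · have := h z (h2.vtx.trans hxy.symm)
      by_cases hz : z ∈ D
      · rw [swf_y hxy hz h2, swf_y hxy (this.1 hz) h2]
      · rw [swf_fix (Or.inl hz), swf_fix (Or.inl (fun hh => hz (this.2 hh)))]
    · rw [swf_fix (Or.inr ⟨h1, h2⟩), swf_fix (Or.inr ⟨h1, h2⟩)]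

theorem swf_congr {m : ℕ} {x y : B.Path} (hxy : vtx m x = vtx m y) {D D' : Set B.Path}
    {z : B.Path} (h : z ∈ D ↔ z ∈ D') : swf m x y D z = swf m x y D' z := by
  by_cases hz : z ∈ D
  · by_cases h1 : eqv m z x
    · rw [swf_x hz h1, swf_x (h.1 hz) h1]
    · by_cases h2 : eqv m z y
      · rw [swf_y hxy hz h2, swf_y hxy (h.1 hz) h2]
      · rw [swf_fix (Or.inr ⟨h1, h2⟩), swf_fix (Or.inr ⟨h1, h2⟩)]
  · rw [swf_fix (Or.inl hz), swf_fix (Or.inl (fun hh => hz (h.2 hh)))]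

theorem TI.union {m : ℕ} {D D' : Set B.Path} (hD : TI m D) (hD' : TI m D') : TI m (D ∪ D') :=
  fun z z' h hz => hz.imp (hD z z' h) (hD' z z' h)

theorem sw_union {m : ℕ} {x y : B.Path} (hxy : vtx m x = vtx m y) {D D' : Set B.Path}
    (hD : TI m D) (hD' : TI m D') (hdis : Disjoint D D') :
    sw m x y (D ∪ D') = sw m x y D * sw m x y D' := by
  have hTI : ∀ E : Set B.Path, TI m E → ∀ z, sw m x y E z ∈ D → z ∈ D := by
    intro E hE z hz
    rw [sw_apply hxy hE] at hz
    exact hD _ _ (fun i hi => swf_ge _ _ _ _ _ hi) hz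
  ext1 z
  rw [Equiv.Perm.mul_apply]
  by_cases hz : z ∈ D
  · have hz' : z ∉ D' := Set.disjoint_left.1 hdis hz
    rw [sw_apply hxy hD', swf_fix (Or.inl hz'), sw_apply hxy hD, sw_apply hxy (hD.union hD')]
    exact swf_congr hxy ⟨fun _ => hz, fun h => Or.inl h⟩
  · rw [sw_apply hxy hD, swf_fix (Or.inl (fun h => hz (hTI D' hD' z h))), sw_apply hxy hD',
      sw_apply hxy (hD.union hD')]
    exact swf_congr hxy ⟨fun h => h.resolve_left hz, fun h => Or.inr h⟩

theorem sw_empty {m : ℕ} {x y : B.Path} (hxy : vtx m x = vtx m y) :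
    sw m x y ∅ = 1 := by
  ext1 z
  rw [sw_apply hxy (fun _ _ _ h => h), swf_fix (Or.inl (Set.notMem_empty z))]
  rfl

end BratteliDiagram
namespace BratteliDiagram

variable {B : BratteliDiagram}

/-- recursive extension -/
def extFun (a : ∀ i, B.E i) : ∀ i, B.E i
  | 0 => a 0
  | i + 1 => by
      classical
      exact if B.src (i + 1) (a (i + 1)) = B.rng i (extFun a i) then a (i + 1)
        else (B.src_surj (i + 1) (B.rng i (extFun a i))).choose

theorem extFun_compat (a : ∀ i, B.E i) (i : ℕ) :
    B.rng i (extFun a i) = B.src (i + 1) (extFun a (i + 1)) := by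
  conv_rhs => rw [extFun]
  split_ifs with h
  · exact h.symm
  · exact (B.src_surj (i + 1) (B.rng i (extFun a i))).choose_spec.symm

theorem extFun_eq (a : ∀ i, B.E i) (n : ℕ)
    (h : ∀ i < n, B.rng i (a i) = B.src (i + 1) (a (i + 1))) : ∀ i ≤ n, extFun a i = a i := by
  intro i
  induction i with
  | zero => intro _; rfl
  | succ i ih =>
    intro hi
    rw [extFun, if_pos]
    rw [ih (by omega), h i (by omega)]

theorem exists_path (a : ∀ i, B.E i) (n : ℕ)
    (h : ∀ i < n, B.rng i (a i) = B.src (i + 1) (a (i + 1))) :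
    ∃ z : B.Path, ∀ i ≤ n, z.1 i = a i :=
  ⟨⟨extFun a, extFun_compat a⟩, extFun_eq a n h⟩

/-- the segment of an infinite path -/
def segOf (m L : ℕ) (z : B.Path) : B.Seg m L :=
  ⟨fun i => z.1 (m + i), fun i _ => z.2 (m + i)⟩

theorem segOf_val (m L : ℕ) (z : B.Path) (i : Fin (L + 1)) :
    (segOf m L z).1 i = z.1 (m + i) := rfl

theorem shift_aux (x : ∀ i, B.E i) (m L : ℕ) (f : ∀ i : Fin (L + 1), B.E (m + (i : ℕ))) :
    ∃ a : ∀ i, B.E i, (∀ i < m, a i = x i) ∧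
      ∀ (j : ℕ) (hj : j < L + 1), a (m + j) = f ⟨j, hj⟩ := by
  classical
  have : ∀ i, ∃ e : B.E i, (i < m → e = x i) ∧
      ∀ (j : ℕ) (hj : j < L + 1) (h : m + j = i), e = h ▸ f ⟨j, hj⟩ := by
    intro i
    by_cases hi : i < m
    · exact ⟨x i, fun _ => rfl, fun j hj h => by omega⟩
    · obtain ⟨j, rfl⟩ : ∃ j, i = m + j := ⟨i - m, by omega⟩
      by_cases hj : j < L + 1
      · refine ⟨f ⟨j, hj⟩, fun h => absurd h hi, fun j' hj' h => ?_⟩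
        obtain rfl : j' = j := by omega
        rfl
      · exact ⟨x _, fun _ => rfl, fun j' hj' h => by omega⟩
  choose a ha ha' using this
  exact ⟨a, ha, fun j hj => ha' (m + j) j hj rfl⟩

theorem ext_seg (x : B.Path) (m L : ℕ) (f : B.Seg m L)
    (h : B.src m (f.1 ⟨0, by omega⟩) = vtx m x) :
    ∃ z : B.Path, eqv m z x ∧ segOf m L z = f := by
  obtain ⟨a, ha, ha'⟩ := shift_aux x.1 m L f.1
  obtain ⟨z, hz⟩ := exists_path a (m + L) (by
    intro i hi
    rcases lt_trichotomy (i + 1) m with h1 | h1 | h1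
    · rw [ha i (by omega), ha (i + 1) h1]; exact x.2 i
    · subst h1
      rw [ha i (by omega)]
      have h2 := ha' 0 (by omega)
      rw [x.2 i]
      exact (h.symm).trans (congrArg _ h2.symm)
    · obtain ⟨j, rfl⟩ : ∃ j, i = m + j := ⟨i - m, by omega⟩
      have h1 := ha' j (by omega)
      have h2 := ha' (j + 1) (by omega)
      have h3 := f.2 j (by omega)
      rw [h1, h3, ← h2]
      rfl)
  refine ⟨z, fun i hi => by rw [hz i (by omega), ha i hi], ?_⟩
  apply Subtype.ext
  funext i
  rw [segOf_val, hz _ (by omega), ha' i.1 i.2]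

theorem vtx_segOf_end (m L : ℕ) (z : B.Path) :
    vtx (m + L + 1) z = B.rng (m + L) ((segOf m L z).1 ⟨L, by omega⟩) := (z.2 (m + L)).symm

theorem vtx_segOf_start (m L : ℕ) (z : B.Path) :
    vtx m z = B.src m ((segOf m L z).1 ⟨0, by omega⟩) := rfl

theorem eqv_seg {m L : ℕ} {z z' : B.Path} :
    eqv (m + L + 1) z z' ↔ eqv m z z' ∧ segOf m L z = segOf m L z' := by
  constructor
  · intro h
    refine ⟨h.mono (by omega), ?_⟩
    apply Subtype.ext
    funext i
    rw [segOf_val, segOf_val]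
    exact h _ (by have := i.2; omega)
  · rintro ⟨h1, h2⟩ i hi
    rcases lt_or_ge i m with h | h
    · exact h1 i h
    · obtain ⟨j, rfl⟩ : ∃ j, i = m + j := ⟨i - m, by omega⟩
      have := congrArg (fun s : B.Seg m L => s.1 ⟨j, by omega⟩) h2
      exact this

instance (m L : ℕ) : Finite (B.Seg m L) := by
  have : ∀ i, Finite (B.E i) := fun i => @Finite.of_fintype _ (B.fintypeE i)
  unfold Seg
  infer_instance

instance finiteV (m : ℕ) : Finite (B.V m) := @Finite.of_fintype _ (B.fintypeV m)

/-- `d` different prefixes outside `A` at each vertex of level `m` -/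
def Big (A : Set B.Path) (d m : ℕ) : Prop :=
  ∀ w : B.V m, ∃ F : Fin d → B.Path, (∀ i, F i ∉ A ∧ vtx m (F i) = w) ∧
    ∀ i j, i ≠ j → ¬ eqv m (F i) (F j)

theorem Big.step {A : Set B.Path} {M : ℕ} (hA : Dep M A) {d m : ℕ} (hm : M ≤ m)
    (h : Big A d m) : Big A d (m + 1) := by
  intro w
  obtain ⟨e, he⟩ := B.rng_surj m w
  obtain ⟨F, hF, hF'⟩ := h (B.src m e)
  have : ∀ i, ∃ z : B.Path, eqv m z (F i) ∧ vtx (m + 1) z = w := by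
    intro i
    let f : B.Seg m 0 := ⟨fun i => if h : i.1 = 0 then (by rw [h]; exact e) else (by have := i.2; omega),
      fun i hi => by omega⟩
    have hf : f.1 ⟨0, by omega⟩ = e := rfl
    obtain ⟨z, hz, hz'⟩ := ext_seg (F i) m 0 f (by rw [hf, (hF i).2])
    refine ⟨z, hz, ?_⟩
    have := vtx_segOf_end m 0 z
    rw [hz', hf] at this
    exact this.trans he
  choose z hz hz' using this
  refine ⟨z, fun i => ⟨fun h => (hF i).1 (hA _ _ ((hz i).mono hm) h), hz' i⟩, fun i j hij h => ?_⟩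
  exact hF' i j hij ((hz i).symm.trans ((h.mono (by omega)).trans (hz j)))

theorem Big.mono_level {A : Set B.Path} {M : ℕ} (hA : Dep M A) {d m m' : ℕ} (hm : M ≤ m)
    (hmm : m ≤ m') (h : Big A d m) : Big A d m' := by
  induction m', hmm using Nat.le_induction with
  | base => exact h
  | succ k hk ih => exact ih.step hA (hm.trans hk)

theorem two_segs (heven : B.IsEven) (m : ℕ) : ∃ L, ∀ (v : B.V m) (w : B.V (m + L + 1)),
    ∃ f f' : B.Seg m L, f ≠ f' ∧ B.src m (f.1 ⟨0, by omega⟩) = v ∧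
      B.src m (f'.1 ⟨0, by omega⟩) = v ∧
      B.rng (m + L) (f.1 ⟨L, by omega⟩) = w ∧ B.rng (m + L) (f'.1 ⟨L, by omega⟩) = w := by
  obtain ⟨L, hL⟩ := heven m
  refine ⟨L, fun v w => ?_⟩
  obtain ⟨h1, h2⟩ := hL v w
  have h3 : 1 < B.numPaths m L v w := by
    rcases h2 with ⟨k, hk⟩
    omega
  unfold numPaths at h3
  rw [Finite.one_lt_card_iff_nontrivial] at h3
  obtain ⟨f, f', hff⟩ := h3
  exact ⟨f.1, f'.1, fun h => hff (Subtype.ext h), f.2.1, f'.2.1, f.2.2, f'.2.2⟩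

theorem big_exists (heven : B.IsEven) {A : Set B.Path} {M : ℕ} (hA : Dep M A)
    (hne : ∃ x, x ∉ A) (d : ℕ) : ∃ m, M ≤ m ∧ Big A (d + 1) m := by
  induction d with
  | zero =>
    obtain ⟨x, hx⟩ := hne
    obtain ⟨L, hL⟩ := two_segs heven M
    refine ⟨M + L + 1, by omega, fun w => ?_⟩
    obtain ⟨f, -, -, h1, -, h2, -⟩ := hL (vtx M x) w
    obtain ⟨z, hz, hz'⟩ := ext_seg x M L f h1
    refine ⟨fun _ => z, fun _ => ⟨fun h => hx (hA _ _ hz h), ?_⟩, fun i j hij => ?_⟩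
    · rw [vtx_segOf_end, hz', h2]
    · exact absurd (Fin.ext (by omega)) hij
  | succ d ih =>
    obtain ⟨m, hm, h⟩ := ih
    obtain ⟨L, hL⟩ := two_segs heven m
    refine ⟨m + L + 1, by omega, fun w => ?_⟩
    obtain ⟨v⟩ := B.nonemptyV m
    obtain ⟨F, hF, hF'⟩ := h v
    obtain ⟨f, f', hff, h1, h1', h2, h2'⟩ := hL v w
    have hz : ∀ i, ∃ z, eqv m z (F i) ∧ segOf m L z = f :=
      fun i => ext_seg (F i) m L f (h1.trans (hF i).2.symm)
    choose z hz hz' using hz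
    obtain ⟨u, hu, hu'⟩ := ext_seg (F 0) m L f' (h1'.trans (hF 0).2.symm)
    have key : ∀ i, ¬ eqv (m + L + 1) u (z i) := by
      intro i h
      have := (eqv_seg.1 h).2
      rw [hu', hz' i] at this
      exact hff this.symm
    refine ⟨Fin.cons u z, fun i => ?_, fun i j hij => ?_⟩
    · refine Fin.cases ?_ (fun i => ?_) i
      · exact ⟨fun h => (hF 0).1 (hA _ _ (hu.mono hm) h), by
          rw [Fin.cons_zero, vtx_segOf_end, hu', h2']⟩
      · exact ⟨fun h => (hF i).1 (hA _ _ ((hz i).mono hm) h), by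
          rw [Fin.cons_succ, vtx_segOf_end, hz', h2]⟩
    · revert hij
      refine Fin.cases ?_ (fun i => ?_) i <;> refine Fin.cases ?_ (fun j => ?_) j
      · intro h; exact absurd rfl h
      · intro _; exact key j
      · intro _ h; exact key i h.symm
      · intro hij h
        exact hF' i j (fun h => hij (by rw [h]))
          ((hz i).symm.trans ((eqv_seg.1 h).1.trans (hz j)))

theorem big (heven : B.IsEven) {A : Set B.Path} {M : ℕ} (hA : Dep M A)
    (hne : ∃ x, x ∉ A) (d : ℕ) : ∃ M', M ≤ M' ∧ ∀ m, M' ≤ m → Big A (d + 1) m := by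
  obtain ⟨m, hm, h⟩ := big_exists heven hA hne d
  exact ⟨m, hm, fun _ hmm => h.mono_level hA hm hmm⟩

/-- the prefix of a path -/
def pre (m : ℕ) (x : B.Path) : ∀ i : Fin m, B.E i := fun i => x.1 i

theorem pre_eq {m : ℕ} {x y : B.Path} : pre m x = pre m y ↔ eqv m x y :=
  ⟨fun h i hi => congrFun h ⟨i, hi⟩, fun h => funext fun i => h i.1 i.2⟩

instance finitePre (m : ℕ) : Finite (∀ i : Fin m, B.E i) := by
  have : ∀ i, Finite (B.E i) := fun i => @Finite.of_fintype _ (B.fintypeE i)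
  infer_instance

theorem generation {A : Set B.Path} {m : ℕ} (hA : Dep m A) (P : Subgroup (Equiv.Perm B.Path))
    (hP : ∀ x y : B.Path, x ∉ A → y ∉ A → vtx m x = vtx m y → ss m x y ∈ P) :
    ∀ g : Equiv.Perm B.Path, g ∈ B.level m → (∀ x ∈ A, g x = x) → g ∈ P := by
  have main : ∀ (N : ℕ) (g : Equiv.Perm B.Path), g ∈ B.level m → (∀ x ∈ A, g x = x) →
      (pre m '' {x | ¬ eqv m (g x) x}).ncard ≤ N → g ∈ P := by
    intro N
    induction N with
    | zero =>
      intro g hg _ hN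
      have h0 := (Set.ncard_eq_zero (Set.toFinite _)).1 (Nat.le_zero.1 hN)
      have : g = 1 := by
        ext1 x
        apply path_ext
        intro i
        rcases lt_or_ge i m with hi | hi
        · by_contra hc
          have : pre m x ∈ pre m '' {x | ¬ eqv m (g x) x} := ⟨x, fun h => hc (h i hi), rfl⟩
          rw [h0] at this
          exact this
        · exact hg.1.1 x i hi
      rw [this]
      exact one_mem _
    | succ N ih =>
      intro g hg hgA hN
      by_cases hx : ∃ x, ¬ eqv m (g x) x
      · obtain ⟨x, hx⟩ := hx
        have hxA : x ∉ A := fun h => hx (by rw [hgA x h]; exact eqv.refl _ _)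
        have hyA : g x ∉ A := fun h => hx (by
          have : g x = x := g.injective (hgA _ h)
          rw [this]; exact eqv.refl _ _)
        have hv : vtx m x = vtx m (g x) := (level_vtx hg x).symm
        have hs := hP x (g x) hxA hyA hv
        have hsl := ss_level hv
        have hsA := (ss_mem_KK hv hA hxA hyA).2
        suffices h : ss m x (g x) * g ∈ P by
          have := P.mul_mem (P.inv_mem hs) h
          rwa [inv_mul_cancel_left] at this
        apply ih _ (mul_mem hsl hg)
        · intro z hz
          rw [Equiv.Perm.mul_apply, hgA z hz, hsA z hz]
        · have hlt : (pre m '' {z | ¬ eqv m ((ss m x (g x) * g) z) z}) ⊂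
              (pre m '' {x | ¬ eqv m (g x) x}) := by
            rw [Set.ssubset_iff_of_subset]
            · refine ⟨pre m x, ⟨x, hx, rfl⟩, ?_⟩
              rintro ⟨z, hz, hzx⟩
              apply hz
              rw [pre_eq] at hzx
              rw [Equiv.Perm.mul_apply]
              exact (ss_y hv ((level_eqv hg).2 hzx)).trans hzx.symm
            · rintro _ ⟨z, hz, rfl⟩
              refine ⟨z, fun h => hz ?_, rfl⟩
              rw [Equiv.Perm.mul_apply]
              have h1 : ¬ eqv m (g z) (g x) := by
                intro h'
                have h2 := (level_eqv hg).1 h'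
                exact hx (h'.symm.trans (h.trans h2))
              have h2 : ¬ eqv m (g z) x := by
                intro h'
                have h3 := h.symm.trans h'
                exact h1 ((level_eqv hg).2 h3)
              rw [ss_ne hv h2 h1]
              exact h
          have := Set.ncard_lt_ncard hlt (Set.toFinite _)
          omega
      · push Not at hx
        apply ih g hg hgA
        have : (pre m '' {x | ¬ eqv m (g x) x}) = ∅ := by
          rw [Set.image_eq_empty]
          ext x
          simp [hx x]
        rw [this]
        simp
  intro g hg hgA
  exact main _ g hg hgA le_rfl

end BratteliDiagram
namespace BratteliDiagram

variable {B : BratteliDiagram}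

theorem map_one_aux {A : Set B.Path} {Q : Type} [Group Q] {p : Equiv.Perm B.Path → Q}
    (hp : ∀ g ∈ KK A, ∀ h ∈ KK A, p (g * h) = p g * p h) : p 1 = 1 := by
  have := hp 1 (one_mem _) 1 (one_mem _)
  rw [one_mul] at this
  exact (mul_eq_left.1 this.symm)

theorem same_aux {A : Set B.Path} {m : ℕ} (hA : Dep m A) {Q : Type} [Group Q] [Finite Q]
    {p : Equiv.Perm B.Path → Q} (hp : ∀ g ∈ KK A, ∀ h ∈ KK A, p (g * h) = p g * p h)
    (hbig : Big A (Nat.card Q + 2) m) {w : B.V m} {a b a' b' : B.Path}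
    (ha : a ∉ A ∧ vtx m a = w) (hb : b ∉ A ∧ vtx m b = w)
    (ha' : a' ∉ A ∧ vtx m a' = w) (hb' : b' ∉ A ∧ vtx m b' = w)
    (hab : ¬ eqv m a b) (hab' : ¬ eqv m a' b') : p (ss m a b) = p (ss m a' b') := by
  have hv : ∀ {u v : B.Path}, u ∉ A ∧ vtx m u = w → v ∉ A ∧ vtx m v = w → vtx m u = vtx m v :=
    fun h h' => h.2.trans h'.2.symm
  have hmem : ∀ {u v : B.Path}, u ∉ A ∧ vtx m u = w → v ∉ A ∧ vtx m v = w → ss m u v ∈ KK A :=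
    fun h h' => ss_mem_KK (hv h h') hA h.1 h'.1
  have good : ∀ {u v z : B.Path}, u ∉ A ∧ vtx m u = w → v ∉ A ∧ vtx m v = w →
      z ∉ A ∧ vtx m z = w → ss m u v z ∉ A ∧ vtx m (ss m u v z) = w := by
    intro u v z hu hv' hz
    refine ⟨fun h => hz.1 ?_, by rw [level_vtx (ss_level (hv hu hv')), hz.2]⟩
    have h1 := (hmem hu hv').2 _ h
    have h2 : ss m u v z = z := (ss m u v).injective h1
    rwa [h2] at h
  -- conjugation
  have conj : ∀ {u v x y z : B.Path}, u ∉ A ∧ vtx m u = w → v ∉ A ∧ vtx m v = w →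
      x ∉ A ∧ vtx m x = w → y ∉ A ∧ vtx m y = w → z ∉ A ∧ vtx m z = w →
      p (ss m x y) = p (ss m x z) →
      p (ss m (ss m u v x) (ss m u v y)) = p (ss m (ss m u v x) (ss m u v z)) := by
    intro u v x y z hu hv' hx hy hz h
    rw [← ss_conj (ss_level (hv hu hv')) (hv hx hy), ← ss_conj (ss_level (hv hu hv')) (hv hx hz)]
    have hs := hmem hu hv'
    rw [hp _ (mul_mem hs (hmem hx hy)) _ (inv_mem hs), hp _ hs _ (hmem hx hy),
      hp _ (mul_mem hs (hmem hx hz)) _ (inv_mem hs), hp _ hs _ (hmem hx hz), h]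
  have ne : ∀ {u v x y : B.Path}, u ∉ A ∧ vtx m u = w → v ∉ A ∧ vtx m v = w →
      ¬ eqv m x y → ¬ eqv m (ss m u v x) (ss m u v y) :=
    fun hu hv' h h' => h ((level_eqv (ss_level (hv hu hv'))).1 h')
  -- pigeonhole
  obtain ⟨a0, b0, c0, ha0, hb0, hc0, h1, h2, h3, h0⟩ : ∃ a0 b0 c0 : B.Path,
      (a0 ∉ A ∧ vtx m a0 = w) ∧ (b0 ∉ A ∧ vtx m b0 = w) ∧ (c0 ∉ A ∧ vtx m c0 = w) ∧
      ¬ eqv m a0 b0 ∧ ¬ eqv m a0 c0 ∧ ¬ eqv m b0 c0 ∧ p (ss m a0 b0) = p (ss m a0 c0) := by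
    obtain ⟨F, hF, hF'⟩ := hbig w
    have hni : ¬ Function.Injective (fun i : Fin (Nat.card Q + 1) => p (ss m (F 0) (F i.succ))) := by
      intro hinj
      have := Nat.card_le_card_of_injective _ hinj
      rw [Nat.card_eq_fintype_card, Fintype.card_fin] at this
      omega
    rw [Function.not_injective_iff] at hni
    obtain ⟨i, j, hij, hne⟩ := hni
    exact ⟨F 0, F i.succ, F j.succ, hF _, hF _, hF _, hF' _ _ (Fin.succ_ne_zero i).symm,
      hF' _ _ (Fin.succ_ne_zero j).symm, hF' _ _ (fun h => hne (Fin.succ_injective _ h)), hij⟩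
  -- three distinct prefixes
  have three : ∀ {a b c : B.Path}, a ∉ A ∧ vtx m a = w → b ∉ A ∧ vtx m b = w →
      c ∉ A ∧ vtx m c = w → ¬ eqv m a b → ¬ eqv m a c → ¬ eqv m b c →
      p (ss m a b) = p (ss m a c) := by
    intro a b c ha hb hc hab hac hbc
    have g1 := good ha0 ha hb0
    have g2 := good ha0 ha hc0
    have e1 := conj ha0 ha ha0 hb0 hc0 h0
    have n1 := ne ha0 ha h1
    have n2 := ne ha0 ha h2
    have n3 := ne ha0 ha h3
    have ea : eqv m (ss m a0 a a0) a := ss_x (hv ha0 ha) (eqv.refl _ _)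
    generalize ss m a0 a b0 = b1 at *
    generalize ss m a0 a c0 = c1 at *
    have hga := good ha0 ha ha0
    rw [ss_congr (hv hga g1) ea (eqv.refl m b1), ss_congr (hv hga g2) ea (eqv.refl m c1)] at e1
    replace n1 : ¬ eqv m a b1 := fun h => n1 (ea.trans h)
    replace n2 : ¬ eqv m a c1 := fun h => n2 (ea.trans h)
    have e2 := conj g1 hb ha g1 g2 e1
    rw [ss_ne (hv g1 hb) n1 hab] at e2
    have g3 := good g1 hb g2
    have n4 := ne g1 hb n2
    rw [ss_ne (hv g1 hb) n1 hab] at n4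
    have n5 := ne g1 hb n3
    have eb : eqv m (ss m b1 b b1) b := ss_x (hv g1 hb) (eqv.refl _ _)
    have hgb := good g1 hb g1
    rw [ss_congr (hv ha hgb) (eqv.refl m a) eb] at e2
    generalize ss m b1 b c1 = c2 at *
    replace n5 : ¬ eqv m b c2 := fun h => n5 (eb.trans h)
    have e3 := conj g3 hc ha hb g3 e2
    rw [ss_ne (hv g3 hc) n4 hac, ss_ne (hv g3 hc) n5 hbc] at e3
    rw [e3]
    have ec : eqv m (ss m c2 c c2) c := ss_x (hv g3 hc) (eqv.refl _ _)
    rw [ss_congr (hv ha (good g3 hc g3)) (eqv.refl m a) ec]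
  have two : ∀ {a b c : B.Path}, a ∉ A ∧ vtx m a = w → b ∉ A ∧ vtx m b = w →
      c ∉ A ∧ vtx m c = w → ¬ eqv m a b → ¬ eqv m a c → p (ss m a b) = p (ss m a c) := by
    intro a b c ha hb hc hab hac
    by_cases hbc : eqv m b c
    · rw [ss_congr (hv ha hb) (eqv.refl m a) hbc]
    · exact three ha hb hc hab hac hbc
  by_cases haa : eqv m a a'
  · rw [two ha hb hb' hab (fun h => hab' (haa.symm.trans h)),
      ss_congr (hv ha hb') haa (eqv.refl m b')]
  · rw [two ha hb ha' hab haa, ss_comm (hv ha ha')]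
    exact two ha' ha hb' (fun h => haa h.symm) hab'

theorem segD_TI (m L : ℕ) (T : Set (B.Seg m L)) : TI m {z : B.Path | segOf m L z ∈ T} := by
  intro z z' h hz
  have : segOf m L z' = segOf m L z := by
    apply Subtype.ext
    funext i
    rw [segOf_val, segOf_val]
    exact (h _ (by omega)).symm
  change segOf m L z' ∈ T
  rw [this]
  exact hz

theorem segD_Dep (m L : ℕ) (T : Set (B.Seg m L)) :
    Dep (m + L + 1) {z : B.Path | segOf m L z ∈ T} := by
  intro z z' h hz
  change segOf m L z' ∈ T
  rw [← (eqv_seg.1 h).2]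
  exact hz

theorem sw_single {m L : ℕ} {x y : B.Path} (hxy : vtx m x = vtx m y) (f : B.Seg m L)
    {x' y' : B.Path} (hx : eqv m x' x) (hy : eqv m y' y) (hx' : segOf m L x' = f)
    (hy' : segOf m L y' = f) :
    sw m x y {z | segOf m L z ∈ ({f} : Set (B.Seg m L))} = ss (m + L + 1) x' y' := by
  have hv : vtx (m + L + 1) x' = vtx (m + L + 1) y' := by
    rw [vtx_segOf_end, vtx_segOf_end, hx', hy']
  have hD := segD_TI m L ({f} : Set (B.Seg m L))
  have key : ∀ z u u' : B.Path, segOf m L z = f → segOf m L u' = f → eqv m u' u →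
      vtx m z = vtx m u → splice m u z = splice (m + L + 1) u' z := by
    intro z u u' hz hu' huu hzu
    have h1 : vtx (m + L + 1) u' = vtx (m + L + 1) z := by
      rw [vtx_segOf_end, vtx_segOf_end, hz, hu']
    apply path_ext
    intro i
    rcases lt_or_ge i m with hi | hi
    · rw [splice_lt hzu.symm hi, splice_lt h1 (by omega), huu i hi]
    · rw [splice_ge _ _ hi]
      rcases lt_or_ge i (m + L + 1) with hi' | hi'
      · rw [splice_lt h1 hi']
        obtain ⟨j, rfl⟩ : ∃ j, i = m + j := ⟨i - m, by omega⟩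
        exact congrArg (fun s : B.Seg m L => s.1 ⟨j, by omega⟩) (hz.trans hu'.symm)
      · rw [splice_ge _ _ hi']
  ext1 z
  unfold ss
  rw [sw_apply hxy hD, sw_apply hv (TI_univ _)]
  by_cases hz : segOf m L z = f
  · by_cases h1 : eqv m z x
    · rw [swf_x hz h1, swf_x (Set.mem_univ _)
        (eqv_seg.2 ⟨h1.trans hx.symm, hz.trans hx'.symm⟩)]
      exact key z y y' hz hy' hy (h1.vtx.trans hxy)
    · by_cases h2 : eqv m z y
      · rw [swf_y hxy hz h2, swf_y hv (Set.mem_univ _)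
          (eqv_seg.2 ⟨h2.trans hy.symm, hz.trans hy'.symm⟩)]
        exact key z x x' hz hx' hx (h2.vtx.trans hxy.symm)
      · rw [swf_fix (Or.inr ⟨h1, h2⟩), swf_fix (Or.inr
          ⟨fun h => h1 ((eqv_seg.1 h).1.trans hx), fun h => h2 ((eqv_seg.1 h).1.trans hy)⟩)]
  · rw [swf_fix (Or.inl hz), swf_fix (Or.inr
      ⟨fun h => hz ((eqv_seg.1 h).2.trans hx'), fun h => hz ((eqv_seg.1 h).2.trans hy')⟩)]

theorem swap_trivial {A : Set B.Path} {m L : ℕ} (hA : Dep m A) {Q : Type} [Group Q] [Finite Q]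
    {p : Equiv.Perm B.Path → Q} (hp : ∀ g ∈ KK A, ∀ h ∈ KK A, p (g * h) = p g * p h)
    (hbig : Big A (Nat.card Q + 2) (m + L + 1))
    (hL : ∀ (v : B.V m) (w : B.V (m + L + 1)), Even (B.numPaths m L v w))
    {x y : B.Path} (hx : x ∉ A) (hy : y ∉ A) (hxy : vtx m x = vtx m y) : p (ss m x y) = 1 := by
  classical
  have hp1 := map_one_aux hp
  by_cases hne : eqv m x y
  · unfold ss
    rw [sw_self hne (TI_univ m), hp1]
  have hA' : Dep (m + L + 1) A := hA.mono (by omega)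
  have memKK : ∀ T : Set (B.Seg m L), sw m x y {z | segOf m L z ∈ T} ∈ KK A := fun T =>
    sw_mem_KK (m' := m + L + 1) (by omega) hxy (segD_TI m L T) (segD_Dep m L T) hA hx hy
  have split : ∀ T T' : Set (B.Seg m L), Disjoint T T' →
      p (sw m x y {z | segOf m L z ∈ T ∪ T'}) =
        p (sw m x y {z | segOf m L z ∈ T}) * p (sw m x y {z | segOf m L z ∈ T'}) := by
    intro T T' h
    have : {z : B.Path | segOf m L z ∈ T ∪ T'} =
        {z : B.Path | segOf m L z ∈ T} ∪ {z : B.Path | segOf m L z ∈ T'} := rfl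
    rw [this, sw_union hxy (segD_TI m L T) (segD_TI m L T') (h.preimage (segOf m L))]
    exact hp _ (memKK T) _ (memKK T')
  have empt : p (sw m x y {z | segOf m L z ∈ (∅ : Set (B.Seg m L))}) = 1 := by
    have : {z : B.Path | segOf m L z ∈ (∅ : Set (B.Seg m L))} = ∅ := rfl
    rw [this, sw_empty hxy, hp1]
  -- segments to a fixed vertex
  have step : ∀ w : B.V (m + L + 1),
      p (sw m x y {z | segOf m L z ∈ {f : B.Seg m L | B.src m (f.1 ⟨0, by omega⟩) = vtx m x ∧
        B.rng (m + L) (f.1 ⟨L, by omega⟩) = w}}) = 1 := by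
    intro w
    obtain ⟨F, hF, hF'⟩ := hbig w
    have h01 : ¬ eqv (m + L + 1) (F 0) (F 1) := hF' 0 1 (by simp)
    set t := p (ss (m + L + 1) (F 0) (F 1)) with ht
    have hv01 : vtx (m + L + 1) (F 0) = vtx (m + L + 1) (F 1) := (hF 0).2.trans (hF 1).2.symm
    have hmem01 := ss_mem_KK hv01 hA' (hF 0).1 (hF 1).1
    have htt : t * t = 1 := by
      rw [ht, ← hp _ hmem01 _ hmem01, ← hp1]
      congr 1
      exact sw_mul_self hv01 (TI_univ _)
    have ind : ∀ T : Finset (B.Seg m L), (∀ f ∈ T, B.src m (f.1 ⟨0, by omega⟩) = vtx m x ∧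
        B.rng (m + L) (f.1 ⟨L, by omega⟩) = w) →
        p (sw m x y {z | segOf m L z ∈ (T : Set (B.Seg m L))}) = t ^ T.card := by
      intro T
      induction T using Finset.induction_on with
      | empty =>
        intro _
        rw [Finset.coe_empty, empt, Finset.card_empty, pow_zero]
      | insert f T hf ih =>
        intro hT
        rw [Finset.coe_insert, Set.insert_eq, split _ _ (by simpa using hf),
          ih (fun f hf => hT f (Finset.mem_insert_of_mem hf)), Finset.card_insert_of_notMem hf,
          pow_succ']
        congr 1
        obtain ⟨hs, hr⟩ := hT f (Finset.mem_insert_self f T)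
        obtain ⟨x', hx', hfx⟩ := ext_seg x m L f hs
        obtain ⟨y', hy', hfy⟩ := ext_seg y m L f (hs.trans hxy)
        rw [sw_single hxy f hx' hy' hfx hfy]
        apply same_aux hA' hp hbig (w := w) _ _ (hF 0) (hF 1) _ h01
        · exact ⟨fun h => hx (hA _ _ hx' h), by rw [vtx_segOf_end, hfx, hr]⟩
        · exact ⟨fun h => hy (hA _ _ hy' h), by rw [vtx_segOf_end, hfy, hr]⟩
        · intro h
          exact hne (hx'.symm.trans ((eqv_seg.1 h).1.trans hy'))
    have hfin : ({f : B.Seg m L | B.src m (f.1 ⟨0, by omega⟩) = vtx m x ∧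
        B.rng (m + L) (f.1 ⟨L, by omega⟩) = w}).Finite := Set.toFinite _
    have h1 := ind hfin.toFinset (fun f hf => by simpa using hf)
    rw [hfin.coe_toFinset] at h1
    rw [h1]
    have hc : hfin.toFinset.card = B.numPaths m L (vtx m x) w := by
      rw [← Set.ncard_eq_toFinset_card _ hfin]
      rfl
    rw [hc]
    obtain ⟨k, hk⟩ := hL (vtx m x) w
    rw [hk, ← two_mul, pow_mul, pow_two, htt, one_pow]
  have ind2 : ∀ W : Finset (B.V (m + L + 1)),
      p (sw m x y {z | segOf m L z ∈ {f : B.Seg m L | B.src m (f.1 ⟨0, by omega⟩) = vtx m x ∧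
        B.rng (m + L) (f.1 ⟨L, by omega⟩) ∈ W}}) = 1 := by
    intro W
    induction W using Finset.induction_on with
    | empty =>
      have : {f : B.Seg m L | B.src m (f.1 ⟨0, by omega⟩) = vtx m x ∧
        B.rng (m + L) (f.1 ⟨L, by omega⟩) ∈ (∅ : Finset (B.V (m + L + 1)))} = ∅ := by
        ext f; simp
      rw [this, empt]
    | insert w W hw ih =>
      have : {f : B.Seg m L | B.src m (f.1 ⟨0, by omega⟩) = vtx m x ∧
          B.rng (m + L) (f.1 ⟨L, by omega⟩) ∈ insert w W} =
          {f : B.Seg m L | B.src m (f.1 ⟨0, by omega⟩) = vtx m x ∧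
            B.rng (m + L) (f.1 ⟨L, by omega⟩) = w} ∪
          {f : B.Seg m L | B.src m (f.1 ⟨0, by omega⟩) = vtx m x ∧
            B.rng (m + L) (f.1 ⟨L, by omega⟩) ∈ W} := by
        ext f
        simp only [Finset.mem_insert, Set.mem_setOf_eq, Set.mem_union]
        tauto
      rw [this, split, step, ih, one_mul]
      rw [Set.disjoint_left]
      rintro f ⟨_, h1⟩ ⟨_, h2⟩
      rw [h1] at h2
      exact hw h2
  have : Fintype (B.V (m + L + 1)) := B.fintypeV _
  have h := ind2 Finset.univ
  unfold ss
  rw [← h]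
  congr 1
  apply sw_congr_D hxy (TI_univ m) (segD_TI m L _)
  intro z hz
  simp only [Set.mem_univ, true_iff, Set.mem_setOf_eq, Finset.mem_univ, and_true]
  exact hz

theorem no_finite_quotient (heven : B.IsEven) {A : Set B.Path} {M : ℕ} (hA : Dep M A)
    (hne : ∃ x, x ∉ A) {Q : Type} [Group Q] [Finite Q]
    {p : Equiv.Perm B.Path → Q} (hp : ∀ g ∈ KK A, ∀ h ∈ KK A, p (g * h) = p g * p h) :
    ∀ g ∈ KK A, p g = 1 := by
  obtain ⟨M', hM, hbig⟩ := big heven hA hne (Nat.card Q + 1)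
  let P : Subgroup (Equiv.Perm B.Path) :=
    { carrier := {g | g ∈ KK A ∧ p g = 1}
      one_mem' := ⟨one_mem _, map_one_aux hp⟩
      mul_mem' := by
        rintro a b ⟨ha, ha'⟩ ⟨hb, hb'⟩
        exact ⟨mul_mem ha hb, by rw [hp a ha b hb, ha', hb', one_mul]⟩
      inv_mem' := by
        rintro a ⟨ha, ha'⟩
        refine ⟨inv_mem ha, ?_⟩
        have := hp a ha a⁻¹ (inv_mem ha)
        rw [mul_inv_cancel, map_one_aux hp, ha', one_mul] at this
        exact this.symm }
  intro g hg
  obtain ⟨n, hn⟩ := hg.1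
  have hAm : Dep (max n M') A := hA.mono (hM.trans (le_max_right _ _))
  have := generation hAm P (fun x y hx hy hxy => by
    refine ⟨ss_mem_KK hxy hAm hx hy, ?_⟩
    obtain ⟨L, hL⟩ := heven (max n M')
    exact swap_trivial hAm hp (hbig _ (by omega)) (fun v w => (hL v w).2) hx hy hxy) g
    (B.level_mono (le_max_left _ _) hn) hg.2
  exact this.2

end BratteliDiagram
namespace BratteliDiagram

variable {B : BratteliDiagram}

instance discE (i : ℕ) : DiscreteTopology (B.E i) := ⟨rfl⟩

instance finE (i : ℕ) : Finite (B.E i) := @Finite.of_fintype _ (B.fintypeE i)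

instance compactPath : CompactSpace B.Path := by
  have hc : IsClosed {x : ∀ i, B.E i | ∀ i, B.rng i (x i) = B.src (i + 1) (x (i + 1))} := by
    rw [Set.setOf_forall]
    refine isClosed_iInter fun i => ?_
    have h1 : Continuous (fun x : ∀ i, B.E i => (x i, x (i + 1))) := by fun_prop
    exact (isClosed_discrete {q : B.E i × B.E (i + 1) | B.rng i q.1 = B.src (i + 1) q.2}).preimage h1
  exact hc.isClosedEmbedding_subtypeVal.compactSpace

theorem continuous_coord (i : ℕ) : Continuous (fun x : B.Path => x.1 i) :=
  (continuous_apply i).comp continuous_subtype_val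

theorem Dep.isOpen {n : ℕ} {A : Set B.Path} (h : Dep n A) : IsOpen A := by
  have hc : Continuous (pre n : B.Path → _) := continuous_pi fun i => continuous_coord i.1
  have : A = pre n ⁻¹' (pre n '' A) := by
    ext x
    constructor
    · exact fun hx => ⟨x, hx, rfl⟩
    · rintro ⟨y, hy, hyx⟩
      exact h y x (pre_eq.1 hyx) hy
  rw [this]
  exact (isOpen_discrete _).preimage hc

theorem open_cyl {A : Set B.Path} (hA : IsOpen A) {x : B.Path} (hx : x ∈ A) :
    ∃ m, ∀ y, eqv m y x → y ∈ A := by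
  obtain ⟨t, ht, rfl⟩ := isOpen_induced_iff.1 hA
  obtain ⟨I, u, h1, h2⟩ := isOpen_pi_iff.1 ht x.1 hx
  refine ⟨I.sup id + 1, fun y hy => h2 ?_⟩
  intro i hi
  have : i ≤ I.sup id := Finset.le_sup (f := id) hi
  rw [hy i (by omega)]
  exact (h1 i hi).2

theorem clopen_dep {A : Set B.Path} (hA : IsClopen A) : ∃ M, Dep M A := by
  have h : ∀ x : B.Path, ∃ m, ∀ y, eqv m y x → (y ∈ A ↔ x ∈ A) := by
    intro x
    by_cases hx : x ∈ A
    · obtain ⟨m, hm⟩ := open_cyl hA.isOpen hx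
      exact ⟨m, fun y hy => ⟨fun _ => hx, fun _ => hm y hy⟩⟩
    · obtain ⟨m, hm⟩ := open_cyl hA.compl.isOpen (x := x) hx
      exact ⟨m, fun y hy => ⟨fun h => absurd h (hm y hy), fun h => absurd h hx⟩⟩
  choose m hm using h
  obtain ⟨t, ht⟩ := isCompact_univ.elim_finite_subcover
    (fun x : B.Path => {y : B.Path | eqv (m x) y x})
    (fun x => Dep.isOpen (n := m x) (fun z z' hz h => hz.symm.trans h))
    (fun x _ => Set.mem_iUnion.2 ⟨x, eqv.refl _ _⟩)
  refine ⟨t.sup m, fun z z' hz h => ?_⟩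
  obtain ⟨x, hx, hzx⟩ := Set.mem_iUnion₂.1 (ht (Set.mem_univ z))
  have h1 : eqv (m x) z z' := hz.mono (Finset.le_sup hx)
  exact (hm x z' (h1.symm.trans hzx)).2 ((hm x z hzx).1 h)

instance finite_level (n : ℕ) : Finite (B.level n) := by
  let γ : B.level n → Set ((∀ i : Fin n, B.E i) × (∀ i : Fin n, B.E i)) :=
    fun g => Set.range fun x : B.Path => (pre n x, pre n (g.1 x))
  apply Finite.of_injective γ
  intro g h hgh
  apply Subtype.ext
  ext1 x
  have h1 : (pre n x, pre n (g.1 x)) ∈ γ h := hgh ▸ ⟨x, rfl⟩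
  obtain ⟨y, hy⟩ := h1
  rw [Prod.mk.injEq, pre_eq, pre_eq] at hy
  apply path_ext
  intro i
  rcases lt_or_ge i n with hi | hi
  · rw [← hy.2 i hi]
    exact (level_eqv h.2).2 hy.1 i hi
  · rw [g.2.1.1 x i hi, h.2.1.1 x i hi]

instance countable_fullGroup : Countable B.fullGroup := by
  have : (B.fullGroup : Set (Equiv.Perm B.Path)) = ⋃ n, (B.level n : Set (Equiv.Perm B.Path)) := by
    ext g
    rw [Set.mem_iUnion]
    rfl
  have h2 : (B.fullGroup : Set (Equiv.Perm B.Path)).Countable := by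
    rw [this]
    exact Set.countable_iUnion fun n => Set.countable_coe_iff.1 (inferInstanceAs (Countable (B.level n)))
  exact h2.to_subtype

instance finite_GcircN (n : ℕ) (A : Set B.Path) : Finite (B.GcircN n A) := by
  let γ : B.GcircN n A → B.level n := fun g => ⟨g.1.1, g.2.1⟩
  apply Finite.of_injective γ
  intro g h hgh
  have := congrArg Subtype.val hgh
  exact Subtype.ext (Subtype.ext this)

theorem mem_Gcirc {A : Set B.Path} {g : B.fullGroup} :
    g ∈ B.Gcirc A ↔ ∀ x ∈ A, g.1 x = x := by
  unfold Gcirc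
  simp only [Subgroup.mem_iInf, MulAction.mem_stabilizer_iff]
  rfl

theorem mem_Gcirc_iff_KK {A : Set B.Path} {g : B.fullGroup} :
    g ∈ B.Gcirc A ↔ g.1 ∈ KK A :=
  mem_Gcirc.trans ⟨fun h => ⟨g.2, h⟩, fun h => h.2⟩

theorem mem_Gcirc_iff_N {A : Set B.Path} {g : B.fullGroup} :
    g ∈ B.Gcirc A ↔ ∃ n, g ∈ B.GcircN n A := by
  constructor
  · intro h
    obtain ⟨n, hn⟩ := g.2
    exact ⟨n, hn, h⟩
  · rintro ⟨n, h⟩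
    exact h.2

theorem GcircN_mono (A : Set B.Path) : Monotone (fun n => B.GcircN n A) := by
  intro m n h g hg
  exact ⟨B.level_mono h hg.1, hg.2⟩

/-- finite orbits are fixed points -/
theorem orbit_dichotomy (heven : B.IsEven) {A : Set B.Path} (hA : IsClopen A)
    (hne : A ≠ Set.univ) {Y : Type} (ρ : B.fullGroup →* Equiv.Perm Y) (y : Y)
    (hfin : {z | ∃ g ∈ B.Gcirc A, ρ g y = z}.Finite) : ∀ g ∈ B.Gcirc A, ρ g y = y := by
  classical
  obtain ⟨M, hM⟩ := clopen_dep hA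
  letI : MulAction (B.Gcirc A) Y := MulAction.compHom Y (ρ.comp (B.Gcirc A).subtype)
  have hsm : ∀ (g : B.Gcirc A) (z : Y), g • z = ρ g.1 z := fun _ _ => rfl
  have : Finite (MulAction.orbit (B.Gcirc A) y) := by
    apply (hfin.subset _).to_subtype
    rintro _ ⟨g, rfl⟩
    exact ⟨g.1, g.2, rfl⟩
  let π := MulAction.toPermHom (B.Gcirc A) (MulAction.orbit (B.Gcirc A) y)
  let p : Equiv.Perm B.Path → Equiv.Perm (MulAction.orbit (B.Gcirc A) y) := fun g =>
    if h : g ∈ KK A then π ⟨⟨g, h.1⟩, mem_Gcirc_iff_KK.2 h⟩ else 1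
  have hp : ∀ g ∈ KK A, ∀ h ∈ KK A, p (g * h) = p g * p h := by
    intro g hg h hh
    simp only [p, dif_pos hg, dif_pos hh, dif_pos (mul_mem hg hh)]
    rw [← map_mul]
    rfl
  intro g hg
  have h1 := no_finite_quotient heven hM ((Set.ne_univ_iff_exists_notMem A).1 hne) hp g.1
    (mem_Gcirc_iff_KK.1 hg)
  simp only [p, dif_pos (mem_Gcirc_iff_KK.1 hg)] at h1
  have h2 := congrArg (fun σ => (σ ⟨y, MulAction.mem_orbit_self y⟩ : MulAction.orbit (B.Gcirc A) y).1) h1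
  exact h2

/-- points outside `A` are moved -/
theorem exists_move (heven : B.IsEven) {A : Set B.Path} (hA : IsClopen A) {x : B.Path}
    (hx : x ∉ A) : ∃ g ∈ B.Gcirc A, g.1 x ≠ x := by
  obtain ⟨M, hM⟩ := clopen_dep hA
  obtain ⟨m, hm, hbig⟩ := big heven hM ⟨x, hx⟩ 1
  obtain ⟨F, hF, hF'⟩ := hbig m le_rfl (vtx m x)
  obtain ⟨y, hy, hyx, hne⟩ : ∃ y, y ∉ A ∧ vtx m x = vtx m y ∧ ¬ eqv m x y := by
    by_cases h : eqv m x (F 0)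
    · exact ⟨F 1, (hF 1).1, (hF 1).2.symm, fun h' => hF' 0 1 (by simp) (h.symm.trans h')⟩
    · exact ⟨F 0, (hF 0).1, (hF 0).2.symm, h⟩
  have hK := ss_mem_KK hyx (hM.mono hm) hx hy
  refine ⟨⟨ss m x y, hK.1⟩, mem_Gcirc_iff_KK.2 hK, fun h => ?_⟩
  have h1 : eqv m (ss m x y x) y := ss_x hyx (eqv.refl _ _)
  change ss m x y x = x at h
  rw [h] at h1
  exact hne h1

end BratteliDiagram

/-- conjugation action as a homomorphism -/
def conjHom (Γ : Type*) [Group Γ] : Γ →* Equiv.Perm (Subgroup Γ) where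
  toFun g := ⟨conjSub g, conjSub g⁻¹, fun H => by
    unfold conjSub
    rw [Subgroup.map_map]
    convert Subgroup.map_id H
    ext x; simp [mul_assoc], fun H => by
    unfold conjSub
    rw [Subgroup.map_map]
    convert Subgroup.map_id H
    ext x; simp [mul_assoc]⟩
  map_one' := by
    ext1 H
    change conjSub 1 H = H
    unfold conjSub
    convert Subgroup.map_id H
    ext x; simp
  map_mul' g h := by
    ext1 H
    change conjSub (g * h) H = conjSub g (conjSub h H)
    unfold conjSub
    rw [Subgroup.map_map]
    congr 1
    ext x; simp [mul_assoc]

theorem conjHom_apply {Γ : Type*} [Group Γ] (g : Γ) (H : Subgroup Γ) :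
    conjHom Γ g H = conjSub g H := rfl

theorem mem_conjSub {Γ : Type*} [Group Γ] (g : Γ) (H : Subgroup Γ) (a : Γ) :
    a ∈ conjSub g H ↔ g⁻¹ * a * g ∈ H := by
  unfold conjSub
  rw [Subgroup.mem_map]
  constructor
  · rintro ⟨x, hx, rfl⟩
    simpa [mul_assoc] using hx
  · intro h
    exact ⟨_, h, by simp [mul_assoc]⟩

theorem measurableSet_subgroup_mem {Γ : Type*} [Group Γ] (a : Γ) :
    MeasurableSet {H : Subgroup Γ | a ∈ H} := by
  refine ⟨{S : Set Γ | a ∈ S}, ?_, rfl⟩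
  exact measurableSet_setOf.2 (measurable_set_mem a)

theorem measurableSet_conj {Γ : Type*} [Group Γ] [Countable Γ] (g : Γ) :
    MeasurableSet {H : Subgroup Γ | conjSub g H = H} := by
  have : {H : Subgroup Γ | conjSub g H = H} =
      ⋂ a : Γ, {H : Subgroup Γ | g⁻¹ * a * g ∈ H ↔ a ∈ H} := by
    ext H
    simp only [Set.mem_iInter]
    change conjSub g H = H ↔ ∀ a, (g⁻¹ * a * g ∈ H ↔ a ∈ H)
    rw [SetLike.ext_iff]
    simp only [mem_conjSub]
  rw [this]
  refine MeasurableSet.iInter fun a => ?_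
  exact measurableSet_setOf.2 ((measurableSet_setOf.1 (measurableSet_subgroup_mem _)).iff
    (measurableSet_setOf.1 (measurableSet_subgroup_mem a)))

namespace BratteliDiagram

variable {B : BratteliDiagram}

theorem FF_inter (heven : B.IsEven) {A A' : Set B.Path} (hA : IsClopen A) (hA' : IsClopen A')
    (hne : A ∪ A' ≠ Set.univ) : B.FF A ∩ B.FF A' = B.FF (A ∩ A') := by
  apply Set.Subset.antisymm
  · rintro H ⟨h1, h2⟩
    obtain ⟨M, hM⟩ := clopen_dep hA
    obtain ⟨M', hM'⟩ := clopen_dep hA'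
    have hU : Dep (max M M') (A ∪ A') := fun z z' hz h =>
      h.imp (hM z z' (hz.mono (le_max_left _ _))) (hM' z z' (hz.mono (le_max_right _ _)))
    have hI : Dep (max M M') (A ∩ A') := fun z z' hz h =>
      h.imp (hM z z' (hz.mono (le_max_left _ _))) (hM' z z' (hz.mono (le_max_right _ _)))
    obtain ⟨M1, hM1, hbig⟩ := big heven hU ((Set.ne_univ_iff_exists_notMem _).1 hne) 0
    let P : Subgroup (Equiv.Perm B.Path) :=
      ((MulAction.stabilizer (Equiv.Perm (Subgroup B.fullGroup)) H).comap
        (conjHom B.fullGroup)).map B.fullGroup.subtype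
    have hP : ∀ g : B.fullGroup, conjSub g H = H → g.1 ∈ P := fun g hg => ⟨g, hg, rfl⟩
    have hP' : ∀ g : B.fullGroup, g.1 ∈ P → conjSub g H = H := by
      rintro g ⟨g', h, h'⟩
      have : g' = g := Subtype.ext h'
      rw [← this]
      exact h
    intro g hg
    obtain ⟨n, hn⟩ := g.2
    apply hP'
    set m := max n M1 with hm
    have hAm : Dep m A := hM.mono (by omega)
    have hAm' : Dep m A' := hM'.mono (by omega)
    have hPA : ∀ x y : B.Path, x ∉ A → y ∉ A → vtx m x = vtx m y → ss m x y ∈ P := by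
      intro x y hx hy hxy
      have hK := ss_mem_KK hxy hAm hx hy
      exact hP ⟨ss m x y, hK.1⟩ (h1 _ (mem_Gcirc_iff_KK.2 hK))
    have hPA' : ∀ x y : B.Path, x ∉ A' → y ∉ A' → vtx m x = vtx m y → ss m x y ∈ P := by
      intro x y hx hy hxy
      have hK := ss_mem_KK hxy hAm' hx hy
      exact hP ⟨ss m x y, hK.1⟩ (h2 _ (mem_Gcirc_iff_KK.2 hK))
    have mixed : ∀ x y : B.Path, x ∉ A → y ∈ A → y ∉ A' → vtx m x = vtx m y →
        ss m x y ∈ P := by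
      intro x y hx hy hy' hxy
      obtain ⟨F, hF, -⟩ := hbig m (le_max_right _ _) (vtx m x)
      obtain ⟨hz, hzv⟩ := hF 0
      generalize F 0 = z at hz hzv
      have hzA : z ∉ A := fun h => hz (Or.inl h)
      have hzA' : z ∉ A' := fun h => hz (Or.inr h)
      have hs := hPA x z hx hzA hzv.symm
      have ht := hPA' z y hzA' hy' (hzv.trans hxy)
      have hc := ss_conj (ss_level hzv.symm) (hzv.trans hxy)
      have e1 : ss m x z y = y := ss_ne hzv.symm (fun h => hx (hAm _ _ h hy))
        (fun h => hzA (hAm _ _ h hy))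
      have e2 : eqv m (ss m x z z) x := ss_y hzv.symm (eqv.refl _ _)
      rw [e1, ss_congr (e2.vtx.trans hxy) e2 (eqv.refl m y)] at hc
      rw [← hc]
      exact mul_mem (mul_mem hs ht) (inv_mem hs)
    refine generation (A := A ∩ A') (m := m) (hI.mono (by omega)) P ?_ g.1
      (B.level_mono (le_max_left _ _) hn) (mem_Gcirc.1 hg)
    intro x y hx hy hxy
    by_cases hxA : x ∈ A
    · have hxA' : x ∉ A' := fun h => hx ⟨hxA, h⟩
      by_cases hyA : y ∈ A
      · exact hPA' x y hxA' (fun h => hy ⟨hyA, h⟩) hxy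
      · rw [ss_comm hxy]
        exact mixed y x hyA hxA hxA' hxy.symm
    · by_cases hyA : y ∈ A
      · exact mixed x y hxA hyA (fun h => hy ⟨hyA, h⟩) hxy
      · exact hPA x y hxA hyA hxy
  · intro H h
    refine ⟨fun g hg => h g ?_, fun g hg => h g ?_⟩
    · exact mem_Gcirc.2 fun x hx => mem_Gcirc.1 hg x hx.1
    · exact mem_Gcirc.2 fun x hx => mem_Gcirc.1 hg x hx.2

end BratteliDiagram
theorem avg_tendsto {Γ Y : Type} [Group Γ] [MeasurableSpace Y] (K : ℕ → Subgroup Γ)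
    [∀ m, Fintype (K m)] (hK : Monotone K) (Kall : Subgroup Γ)
    (hKall : ∀ g, g ∈ Kall ↔ ∃ m, g ∈ K m) (ρ : Γ →* Equiv.Perm Y) (ν : Measure Y)
    [IsFiniteMeasure ν] (hmeas : ∀ g, MeasurableSet {y | ρ g y = y})
    (hdich : ∀ y, {z | ∃ g ∈ Kall, ρ g y = z}.Finite → ∀ g ∈ Kall, ρ g y = y) :
    Tendsto (fun m => (∑ g : K m, ν {y | ρ g.1 y = y}) * (Fintype.card (K m) : ℝ≥0∞)⁻¹) atTop
      (nhds (ν {y | ∀ g ∈ Kall, ρ g y = y})) := by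
  classical
  let f : ℕ → Y → ℝ≥0∞ := fun m y =>
    (∑ g : K m, Set.indicator {y | ρ g.1 y = y} (fun _ => (1 : ℝ≥0∞)) y) *
      (Fintype.card (K m) : ℝ≥0∞)⁻¹
  let F : Y → ℝ≥0∞ := Set.indicator {y | ∀ g ∈ Kall, ρ g y = y} (fun _ => (1 : ℝ≥0∞))
  have hind : ∀ g : Γ, Measurable (Set.indicator {y | ρ g y = y} (fun _ => (1 : ℝ≥0∞))) :=
    fun g => measurable_const.indicator (hmeas g)
  have hfm : ∀ m, Measurable (f m) := fun m =>
    (Finset.measurable_fun_sum _ fun g _ => hind g.1).mul_const _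
  have hset : MeasurableSet {y | ∀ g ∈ Kall, ρ g y = y} := by
    have : {y | ∀ g ∈ Kall, ρ g y = y} = ⋂ m, ⋂ g : K m, {y | ρ g.1 y = y} := by
      ext y
      simp only [Set.mem_iInter]
      constructor
      · intro h m g
        exact h g.1 ((hKall _).2 ⟨m, g.2⟩)
      · intro h g hg
        obtain ⟨m, hm⟩ := (hKall g).1 hg
        exact h m ⟨g, hm⟩
    rw [this]
    exact MeasurableSet.iInter fun m => MeasurableSet.iInter fun g => hmeas g.1
  have hcard : ∀ m, (Fintype.card (K m) : ℝ≥0∞) ≠ 0 := fun m => by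
    exact_mod_cast Fintype.card_ne_zero
  have hf1 : ∀ m y, f m y ≤ 1 := by
    intro m y
    have : (∑ g : K m, Set.indicator {y | ρ g.1 y = y} (fun _ => (1 : ℝ≥0∞)) y) ≤
        Fintype.card (K m) := by
      refine (Finset.sum_le_card_nsmul _ _ 1 fun g _ => ?_).trans ?_
      · exact Set.indicator_apply_le' (fun _ => le_rfl) (fun _ => zero_le_one)
      · simp
    refine (mul_le_mul_left this _).trans ?_
    rw [ENNReal.mul_inv_cancel (hcard m) (ENNReal.natCast_ne_top _)]
  have hlim : ∀ y, Tendsto (fun m => f m y) atTop (nhds (F y)) := by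
    intro y
    by_cases hy : ∀ g ∈ Kall, ρ g y = y
    · have h1 : F y = 1 := Set.indicator_of_mem (s := {y | ∀ g ∈ Kall, ρ g y = y}) hy _
      have h2 : ∀ m, f m y = 1 := by
        intro m
        have : ∀ g : K m, Set.indicator {y | ρ g.1 y = y} (fun _ => (1 : ℝ≥0∞)) y = 1 :=
          fun g => Set.indicator_of_mem (s := {y | ρ g.1 y = y}) (hy g.1 ((hKall _).2 ⟨m, g.2⟩)) _
        simp only [f, this]
        simp only [Finset.sum_const, Finset.card_univ, nsmul_eq_mul, mul_one]
        exact ENNReal.mul_inv_cancel (hcard m) (ENNReal.natCast_ne_top _)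
      simp only [h1, h2]
      exact tendsto_const_nhds
    · have h1 : F y = 0 := Set.indicator_of_notMem (s := {y | ∀ g ∈ Kall, ρ g y = y}) hy _
      rw [h1, ENNReal.tendsto_nhds_zero]
      intro ε hε
      obtain ⟨n, hn⟩ := ENNReal.exists_inv_nat_lt hε.ne'
      have hinf : {z | ∃ g ∈ Kall, ρ g y = z}.Infinite := fun h => hy (hdich y h)
      obtain ⟨t, ht, htn⟩ := hinf.exists_subset_card_eq n
      have hev : ∀ᶠ m in atTop, ∀ z ∈ t, ∃ g ∈ K m, ρ g y = z := by
        rw [Filter.eventually_all_finset]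
        intro z hz
        obtain ⟨g, hg, hgz⟩ := ht hz
        obtain ⟨m, hm⟩ := (hKall g).1 hg
        filter_upwards [eventually_ge_atTop m] with m' hm'
        exact ⟨g, hK hm' hm, hgz⟩
      filter_upwards [hev] with m hm
      refine le_trans ?_ hn.le
      letI : MulAction (K m) Y := MulAction.compHom Y (ρ.comp (K m).subtype)
      have hsub : (t : Set Y) ⊆ MulAction.orbit (K m) y := by
        intro z hz
        obtain ⟨g, hg, h⟩ := hm z hz
        exact ⟨⟨g, hg⟩, h⟩
      have hfin : (MulAction.orbit (K m) y).Finite := Set.finite_range _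
      haveI : Fintype (MulAction.orbit (K m) y) := hfin.fintype
      have hos := MulAction.card_orbit_mul_card_stabilizer_eq_card_group (K m) y
      have hle : n ≤ Fintype.card (MulAction.orbit (K m) y) := by
        rw [← htn, ← Set.toFinset_card]
        apply Finset.card_le_card
        intro z hz
        rw [Set.mem_toFinset]
        exact hsub hz
      have hs : (∑ g : K m, Set.indicator {y | ρ g.1 y = y} (fun _ => (1 : ℝ≥0∞)) y) =
          Fintype.card (MulAction.stabilizer (K m) y) := by
        have : ∀ g : K m, Set.indicator {y | ρ g.1 y = y} (fun _ => (1 : ℝ≥0∞)) y =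
          if g ∈ MulAction.stabilizer (K m) y then 1 else 0 := by
          intro g
          rw [Set.indicator_apply]
          rfl
        simp only [this]
        rw [Finset.sum_boole, Fintype.card_subtype]
      have hn0 : (n : ℝ≥0∞) ≠ 0 ∨ n = 0 := by
        rcases Nat.eq_zero_or_pos n with h | h
        · exact Or.inr h
        · left; exact_mod_cast h.ne'
      rcases hn0 with hn0 | hn0
      · change (∑ g : K m, Set.indicator {y | ρ g.1 y = y} (fun _ => (1 : ℝ≥0∞)) y) *
          (Fintype.card (K m) : ℝ≥0∞)⁻¹ ≤ _
        rw [hs, ← div_eq_mul_inv, ENNReal.div_le_iff (hcard m) (ENNReal.natCast_ne_top _),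
          mul_comm, ← div_eq_mul_inv,
          ENNReal.le_div_iff_mul_le (Or.inl hn0) (Or.inl (ENNReal.natCast_ne_top _))]
        rw [mul_comm]
        exact_mod_cast (Nat.mul_le_mul_right _ hle).trans hos.le
      · rw [hn0]; simp
  have key := tendsto_lintegral_of_dominated_convergence (μ := ν) (F := f) (f := F)
    (fun _ => 1) hfm (fun m => ae_of_all _ (hf1 m))
    (by simp) (ae_of_all _ hlim)
  have hF : ∫⁻ y, F y ∂ν = ν {y | ∀ g ∈ Kall, ρ g y = y} := by
    simpa using lintegral_indicator_const (μ := ν) hset 1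
  have hfi : ∀ m, ∫⁻ y, f m y ∂ν =
      (∑ g : K m, ν {y | ρ g.1 y = y}) * (Fintype.card (K m) : ℝ≥0∞)⁻¹ := by
    intro m
    simp only [f]
    rw [lintegral_mul_const _ (Finset.measurable_fun_sum _ fun g _ => hind g.1),
      lintegral_finset_sum _ (fun g _ => hind g.1)]
    congr 1
    refine Finset.sum_congr rfl fun g _ => ?_
    simpa using lintegral_indicator_const (μ := ν) (hmeas g.1) 1
  rw [hF] at key
  simpa only [hfi] using key
namespace BratteliDiagram

variable {B : BratteliDiagram}

instance borelPath : BorelSpace B.Path := ⟨rfl⟩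

/-- the disjoint union of all the finite powers of the path space -/
abbrev PowSpace (B : BratteliDiagram) (k : ℕ) : Type :=
  Σ α : Fin k → ℕ, ((Σ i : Fin k, Fin (α i)) → B.Path)

/-- inclusion of a power -/
abbrev mkP {k : ℕ} (α : Fin k → ℕ) (y : (Σ i : Fin k, Fin (α i)) → B.Path) : PowSpace B k :=
  ⟨α, y⟩

/-- the mixture of the product measures -/
def mixMeasure {k : ℕ} (μ : Fin k → Measure B.Path) (c : (Fin k → ℕ) → ℝ≥0∞) :
    Measure (PowSpace B k) :=
  Measure.sum fun α => c α • (B.prodMeasure μ α).map (mkP α)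

/-- tuples with all entries in `A` -/
def EE {k : ℕ} (A : Set B.Path) : Set (PowSpace B k) := {y | ∀ p, y.2 p ∈ A}

theorem measurable_sigmaMk {k : ℕ} (α : Fin k → ℕ) :
    Measurable (mkP α : _ → PowSpace B k) := by
  intro s hs
  exact (MeasurableSpace.measurableSet_iInf.1 hs) α

theorem measurableSet_sigma {k : ℕ} {s : Set (PowSpace B k)}
    (h : ∀ α, MeasurableSet (mkP α ⁻¹' s)) : MeasurableSet s :=
  MeasurableSpace.measurableSet_iInf.2 h

theorem mixMeasure_apply {k : ℕ} (μ : Fin k → Measure B.Path) (c : (Fin k → ℕ) → ℝ≥0∞)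
    {s : Set (PowSpace B k)} (hs : MeasurableSet s) :
    mixMeasure μ c s = ∑' α, c α * B.prodMeasure μ α (mkP α ⁻¹' s) := by
  unfold mixMeasure
  rw [Measure.sum_apply _ hs]
  refine tsum_congr fun α => ?_
  rw [Measure.smul_apply, Measure.map_apply (measurable_sigmaMk α) hs, smul_eq_mul]

theorem prodMeasure_prob {k : ℕ} {μ : Fin k → Measure B.Path}
    (hprob : ∀ i, IsProbabilityMeasure (μ i)) (α : Fin k → ℕ) :
    IsProbabilityMeasure (B.prodMeasure μ α) := by
  unfold prodMeasure
  infer_instance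

theorem mixMeasure_finite {k : ℕ} {μ : Fin k → Measure B.Path}
    (hprob : ∀ i, IsProbabilityMeasure (μ i)) {c : (Fin k → ℕ) → ℝ≥0∞}
    (hc : ∑' α, c α ≠ ∞) : IsFiniteMeasure (mixMeasure μ c) := by
  constructor
  rw [mixMeasure_apply μ c MeasurableSet.univ]
  refine lt_of_le_of_lt (ENNReal.tsum_le_tsum fun α => ?_) hc.lt_top
  have := prodMeasure_prob hprob α
  exact (mul_le_mul_right prob_le_one _).trans (mul_one _).le

theorem measurableSet_fixPath (g : B.fullGroup) : MeasurableSet {x : B.Path | g.1 x = x} := by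
  obtain ⟨n, hn⟩ := g.2
  have h : Dep n {x : B.Path | g.1 x = x} := by
    intro x y hxy hx
    change g.1 y = y
    change g.1 x = x at hx
    have h1 : eqv n (g.1 x) (g.1 y) := fun i hi => hn.1.2 x y hxy i hi
    apply path_ext
    intro i
    rcases lt_or_ge i n with hi | hi
    · rw [← h1 i hi, hx]
      exact hxy i hi
    · exact hn.1.1 y i hi
  exact h.isOpen.measurableSet

/-- diagonal action on the disjoint union of powers -/
def powHom (B : BratteliDiagram) (k : ℕ) : B.fullGroup →* Equiv.Perm (PowSpace B k) where
  toFun g := Equiv.sigmaCongrRight fun _ => MulAction.toPerm g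
  map_one' := by
    ext1 ⟨α, y⟩
    exact congrArg (Sigma.mk α) (one_smul B.fullGroup y)
  map_mul' g h := by
    ext1 ⟨α, y⟩
    exact congrArg (Sigma.mk α) (mul_smul g h y)

theorem powHom_fix {k : ℕ} (g : B.fullGroup) (y : PowSpace B k) :
    powHom B k g y = y ↔ ∀ p, g.1 (y.2 p) = y.2 p := by
  obtain ⟨α, y⟩ := y
  change (⟨α, g • y⟩ : PowSpace B k) = ⟨α, y⟩ ↔ _
  rw [Sigma.mk.injEq]
  simp only [heq_eq_eq, true_and]
  exact funext_iff

theorem measurableSet_powFix {k : ℕ} (g : B.fullGroup) :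
    MeasurableSet {y : PowSpace B k | powHom B k g y = y} := by
  apply measurableSet_sigma
  intro α
  have : (mkP α ⁻¹' {y : PowSpace B k | powHom B k g y = y}) =
      ⋂ p, (fun y : (Σ i : Fin k, Fin (α i)) → B.Path => y p) ⁻¹' {x | g.1 x = x} := by
    ext y
    simp only [Set.mem_iInter]
    exact powHom_fix g ⟨α, y⟩
  rw [this]
  exact MeasurableSet.iInter fun p => measurable_pi_apply p (measurableSet_fixPath g)

theorem measurableSet_EE {k : ℕ} {A : Set B.Path} (hA : MeasurableSet A) :
    MeasurableSet (EE A : Set (PowSpace B k)) := by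
  apply measurableSet_sigma
  intro α
  have : (mkP α ⁻¹' (EE A : Set (PowSpace B k))) =
      ⋂ p, (fun y : (Σ i : Fin k, Fin (α i)) → B.Path => y p) ⁻¹' A := by
    ext y
    simp only [Set.mem_iInter]
    rfl
  rw [this]
  exact MeasurableSet.iInter fun p => measurable_pi_apply p hA

theorem measurableSet_FF (A : Set B.Path) : MeasurableSet (B.FF A) := by
  have : B.FF A = ⋂ g : B.Gcirc A, {H | conjSub g.1 H = H} := by
    ext H
    simp only [Set.mem_iInter]
    exact ⟨fun h g => h g.1 g.2, fun h g hg => h ⟨g, hg⟩⟩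
  rw [this]
  exact MeasurableSet.iInter fun g => measurableSet_conj g.1

theorem phi_FF (heven : B.IsEven) {k : ℕ} {μ : Fin k → Measure B.Path}
    (hprob : ∀ i, IsProbabilityMeasure (μ i)) (φ : Measure (Subgroup B.fullGroup))
    [IsFiniteMeasure φ] (c : (Fin k → ℕ) → ℝ≥0∞) (cinf : ℝ≥0∞)
    (hc : ∑' α, c α ≠ ∞) (hcinf : cinf ≠ ∞)
    (hchar : ∀ g : ↥B.fullGroup,
      φ {H : Subgroup ↥B.fullGroup | conjSub g H = H}
        = ({1} : Set ↥B.fullGroup).indicator (fun _ => cinf) g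
          + ∑' α : Fin k → ℕ,
              c α * B.prodMeasure μ α {y : (Σ i : Fin k, Fin (α i)) → B.Path | g • y = y})
    {A : Set B.Path} (hA : IsClopen A) (hne : A ≠ Set.univ) :
    φ (B.FF A) = mixMeasure μ c (EE A) := by
  classical
  haveI : ∀ m, Fintype (B.GcircN m A) := fun m => Fintype.ofFinite _
  haveI := mixMeasure_finite hprob hc
  have ha := avg_tendsto (fun m => B.GcircN m A) (GcircN_mono A) (B.Gcirc A)
    (fun g => mem_Gcirc_iff_N) (conjHom B.fullGroup) φ (fun g => measurableSet_conj g)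
    (fun y hy => orbit_dichotomy heven hA hne (conjHom B.fullGroup) y hy)
  have hb := avg_tendsto (fun m => B.GcircN m A) (GcircN_mono A) (B.Gcirc A)
    (fun g => mem_Gcirc_iff_N) (powHom B k) (mixMeasure μ c) (fun g => measurableSet_powFix g)
    (fun y hy => orbit_dichotomy heven hA hne (powHom B k) y hy)
  letI : MeasurableSpace B.fullGroup := ⊤
  let L : B.fullGroup →* Equiv.Perm B.fullGroup := MulAction.toPermHom B.fullGroup B.fullGroup
  haveI : IsFiniteMeasure (cinf • Measure.dirac (1 : B.fullGroup)) := by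
    constructor
    rw [Measure.smul_apply, smul_eq_mul]
    exact ENNReal.mul_lt_top hcinf.lt_top (measure_lt_top _ _)
  have hd := avg_tendsto (fun m => B.GcircN m A) (GcircN_mono A) (B.Gcirc A)
    (fun g => mem_Gcirc_iff_N) L (cinf • Measure.dirac (1 : B.fullGroup)) (fun g => trivial)
    (fun y hy => orbit_dichotomy heven hA hne L y hy)
  have e1 : {y : PowSpace B k | ∀ g ∈ B.Gcirc A, powHom B k g y = y} = EE A := by
    ext y
    constructor
    · intro h p
      by_contra hp
      obtain ⟨g, hg, hgy⟩ := exists_move heven hA hp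
      exact hgy ((powHom_fix g y).1 (h g hg) p)
    · intro h g hg
      exact (powHom_fix g y).2 fun p => mem_Gcirc.1 hg _ (h p)
  have hL : ∀ g y : B.fullGroup, L g y = y ↔ g = 1 := by
    intro g y
    change g * y = y ↔ _
    exact mul_eq_right
  have e2 : {y : B.fullGroup | ∀ g ∈ B.Gcirc A, L g y = y} = ∅ := by
    ext y
    simp only [Set.mem_empty_iff_false, iff_false]
    intro h
    obtain ⟨x, hx⟩ := (Set.ne_univ_iff_exists_notMem A).1 hne
    obtain ⟨g, hg, hgx⟩ := exists_move heven hA hx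
    rw [(hL g y).1 (h g hg)] at hgx
    exact hgx rfl
  rw [e1] at hb
  rw [e2, measure_empty] at hd
  have hsum := hd.add hb
  rw [zero_add] at hsum
  refine tendsto_nhds_unique ha (hsum.congr fun m => ?_)
  rw [← add_mul, ← Finset.sum_add_distrib]
  congr 1
  refine Finset.sum_congr rfl fun g _ => ?_
  change _ = φ {H : Subgroup ↥B.fullGroup | conjSub g.1 H = H}
  rw [hchar g.1]
  congr 1
  · rw [Measure.smul_apply, smul_eq_mul]
    by_cases h : g.1 = 1
    · have : {y : B.fullGroup | L g.1 y = y} = Set.univ := by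
        ext y
        simpa using (hL g.1 y).2 h
      rw [this, h]
      simp
    · have : {y : B.fullGroup | L g.1 y = y} = ∅ := by
        ext y
        simpa using fun h' => h ((hL g.1 y).1 h')
      rw [this]
      simp [h]
  · rw [mixMeasure_apply μ c (measurableSet_powFix g.1)]
    refine tsum_congr fun α => ?_
    congr 2
    ext y
    exact (powHom_fix g.1 ⟨α, y⟩).trans funext_iff.symm

theorem EE_inter {k : ℕ} (A A' : Set B.Path) :
    (EE A ∩ EE A' : Set (PowSpace B k)) = EE (A ∩ A') := by
  ext y
  exact ⟨fun h p => ⟨h.1 p, h.2 p⟩, fun h => ⟨fun p => (h p).1, fun p => (h p).2⟩⟩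

theorem incl_excl {k : ℕ} (heven : B.IsEven) (φ : Measure (Subgroup B.fullGroup))
    [IsFiniteMeasure φ] (ν : Measure (PowSpace B k)) [IsFiniteMeasure ν]
    (Good : Set B.Path → Prop) (hG : ∀ A, Good A → IsClopen A)
    (hGi : ∀ A A', Good A → Good A' → Good (A ∩ A'))
    (hGu : ∀ A A', Good A → Good A' → A ∪ A' ≠ Set.univ)
    (heq : ∀ A, Good A → φ (B.FF A) = ν (EE A))
    {ι : Type} (T : Finset ι) (A : ι → Set B.Path) (hA : ∀ i ∈ T, Good (A i)) :
    φ (⋃ i ∈ T, B.FF (A i)) = ν (⋃ i ∈ T, EE (A i)) := by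
  classical
  induction T using Finset.induction_on generalizing A with
  | empty => simp
  | insert a T ha ih =>
    have hAa : Good (A a) := hA a (Finset.mem_insert_self _ _)
    have hAT : ∀ i ∈ T, Good (A i) := fun i hi => hA i (Finset.mem_insert_of_mem hi)
    have h1 := ih A hAT
    have h2 := ih (fun i => A a ∩ A i) fun i hi => hGi _ _ hAa (hAT i hi)
    have m1 : MeasurableSet (⋃ i ∈ T, B.FF (A i)) :=
      Finset.measurableSet_biUnion _ fun i _ => measurableSet_FF _
    have m2 : MeasurableSet (⋃ i ∈ T, (EE (A i) : Set (PowSpace B k))) :=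
      Finset.measurableSet_biUnion _ fun i hi => measurableSet_EE (hG _ (hAT i hi)).isOpen.measurableSet
    have i1 : B.FF (A a) ∩ ⋃ i ∈ T, B.FF (A i) = ⋃ i ∈ T, B.FF (A a ∩ A i) := by
      rw [Set.inter_iUnion₂]
      exact Set.iUnion₂_congr fun i hi =>
        FF_inter heven (hG _ hAa) (hG _ (hAT i hi)) (hGu _ _ hAa (hAT i hi))
    have i2 : (EE (A a) : Set (PowSpace B k)) ∩ ⋃ i ∈ T, EE (A i) = ⋃ i ∈ T, EE (A a ∩ A i) := by
      rw [Set.inter_iUnion₂]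
      exact Set.iUnion₂_congr fun i hi => EE_inter _ _
    have u1 := measure_union_add_inter (μ := φ) (B.FF (A a)) m1
    have u2 := measure_union_add_inter (μ := ν) (EE (A a)) m2
    rw [i1, h1, h2, heq _ hAa, ← u2, i2] at u1
    rw [Finset.set_biUnion_insert, Finset.set_biUnion_insert]
    exact (ENNReal.add_left_inj (measure_ne_top _ _)).1 u1

end BratteliDiagram
/-- with the decomposition as above, `r` the minimal `|β|` with `c_β > 0` and
`β₀` attaining it, for every `n ≥ N` one has `φ(⋃_{C̄∈Ξ_{r,n}} F(∪C̄)) ≥ c_{β₀} > 0`. -/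
theorem phi_union_FF_lower_bound (B : BratteliDiagram)
    (hsimple : B.IsSimple) (heven : B.IsEven)
    (k : ℕ) (hk : 1 ≤ k) (μ : Fin k → Measure B.Path)
    (hprob : ∀ i, IsProbabilityMeasure (μ i))
    (hinv : ∀ i, MeasInv ↥B.fullGroup (μ i))
    (herg : ∀ i, MeasErg ↥B.fullGroup (μ i))
    (hdistinct : Function.Injective μ)
    (hcomplete : ∀ ν : Measure B.Path, IsProbabilityMeasure ν →
      MeasInv ↥B.fullGroup ν → MeasErg ↥B.fullGroup ν → ∃ i, ν = μ i)
    (φ : Measure (Subgroup ↥B.fullGroup)) (hφ : IsErgodicIRS ↥B.fullGroup φ)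
    (hatomless : ∀ H : Subgroup ↥B.fullGroup, φ {H} = 0)
    (c : (Fin k → ℕ) → ℝ≥0∞) (cinf : ℝ≥0∞)
    (hsum : cinf + ∑' α : Fin k → ℕ, c α = 1)
    (hchar : ∀ g : ↥B.fullGroup,
      φ {H : Subgroup ↥B.fullGroup | conjSub g H = H}
        = ({1} : Set ↥B.fullGroup).indicator (fun _ => cinf) g
          + ∑' α : Fin k → ℕ,
              c α * B.prodMeasure μ α {y : (Σ i : Fin k, Fin (α i)) → B.Path | g • y = y})
    (r : ℕ) (β₀ : Fin k → ℕ) (hβ₀r : ∑ i, β₀ i = r) (hβ₀pos : 0 < c β₀)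
    (hrmin : ∀ β : Fin k → ℕ, c β ≠ 0 → r ≤ ∑ i, β i)
    (Ξ : ℕ → Finset (Set B.Path))
    (hclopen : ∀ n, ∀ C ∈ Ξ n, IsClopen C)
    (hnonempty : ∀ n, ∀ C ∈ Ξ n, C.Nonempty)
    (hdisj : ∀ n, ∀ C ∈ Ξ n, ∀ D ∈ Ξ n, C ≠ D → Disjoint C D)
    (hcover : ∀ n, ⋃₀ (↑(Ξ n) : Set (Set B.Path)) = Set.univ)
    (hnested : ∀ n, ∀ C ∈ Ξ (n + 1), ∃ D ∈ Ξ n, C ⊆ D)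
    (hmesh : ∀ U ∈ uniformity B.Path, ∀ᶠ n in Filter.atTop, ∀ C ∈ Ξ n, C ×ˢ C ⊆ U)
    (N : ℕ)
    (hN : ∀ p ≤ r, ∀ n, N ≤ n →
      ∀ S ∈ Finset.powersetCard p (Ξ n), ∀ T ∈ Finset.powersetCard p (Ξ n),
        ⋃₀ (↑S : Set (Set B.Path)) ∪ ⋃₀ (↑T : Set (Set B.Path)) ≠ Set.univ)
    (n : ℕ) (hn : N ≤ n) :
    c β₀ ≤ φ (⋃ S ∈ Finset.powersetCard r (Ξ n), B.FF (⋃₀ (↑S : Set (Set B.Path)))) := by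
  classical
  have hφp : IsProbabilityMeasure φ := hφ.1.1
  have hc : ∑' α, c α ≠ ∞ := by
    refine ne_top_of_le_ne_top ENNReal.one_ne_top ?_
    rw [← hsum]
    exact le_add_self
  have hcinf : cinf ≠ ∞ := by
    refine ne_top_of_le_ne_top ENNReal.one_ne_top ?_
    rw [← hsum]
    exact le_self_add
  have hfin := BratteliDiagram.mixMeasure_finite hprob hc
  let Good : Set B.Path → Prop := fun A =>
    IsClopen A ∧ ∃ S ∈ Finset.powersetCard r (Ξ n), A ⊆ ⋃₀ (↑S : Set (Set B.Path))
  have hGu : ∀ A A', Good A → Good A' → A ∪ A' ≠ Set.univ := by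
    rintro A A' ⟨-, S, hS, hAS⟩ ⟨-, S', hS', hAS'⟩ h
    apply hN r le_rfl n hn S hS S' hS'
    rw [← Set.univ_subset_iff, ← h]
    exact Set.union_subset_union hAS hAS'
  have hGood : ∀ S ∈ Finset.powersetCard r (Ξ n), Good (⋃₀ (↑S : Set (Set B.Path))) := by
    intro S hS
    refine ⟨?_, S, hS, subset_rfl⟩
    rw [Set.sUnion_eq_biUnion]
    exact S.finite_toSet.isClopen_biUnion fun C hC =>
      hclopen n C ((Finset.mem_powersetCard.1 hS).1 hC)
  have key := BratteliDiagram.incl_excl heven φ (BratteliDiagram.mixMeasure μ c) Good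
    (fun A h => h.1)
    (fun A A' h h' => ⟨h.1.inter h'.1, h.2.imp fun S hS =>
      ⟨hS.1, Set.inter_subset_left.trans hS.2⟩⟩)
    hGu
    (fun A h => BratteliDiagram.phi_FF heven hprob φ c cinf hc hcinf hchar h.1
      (fun h' => hGu A A h h (by rw [Set.union_self, h'])))
    (Finset.powersetCard r (Ξ n)) (fun S => ⋃₀ (↑S : Set (Set B.Path))) hGood
  rw [key]
  have hcard : r ≤ (Ξ n).card := by
    by_contra hlt
    refine hN (Ξ n).card (by omega) n hn (Ξ n) ?_ (Ξ n) ?_ ?_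
    · exact Finset.mem_powersetCard.2 ⟨subset_rfl, rfl⟩
    · exact Finset.mem_powersetCard.2 ⟨subset_rfl, rfl⟩
    · rw [Set.union_self, hcover]
  have hmeasU : MeasurableSet (⋃ S ∈ Finset.powersetCard r (Ξ n),
      (BratteliDiagram.EE (⋃₀ (↑S : Set (Set B.Path))) : Set (BratteliDiagram.PowSpace B k))) :=
    Finset.measurableSet_biUnion _ fun S hS =>
      BratteliDiagram.measurableSet_EE (hGood S hS).1.isOpen.measurableSet
  rw [BratteliDiagram.mixMeasure_apply μ c hmeasU]
  refine le_trans ?_ (ENNReal.le_tsum β₀)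
  have huniv : BratteliDiagram.mkP β₀ ⁻¹' (⋃ S ∈ Finset.powersetCard r (Ξ n),
      (BratteliDiagram.EE (⋃₀ (↑S : Set (Set B.Path))) : Set (BratteliDiagram.PowSpace B k)))
      = Set.univ := by
    rw [Set.eq_univ_iff_forall]
    intro y
    have hat : ∀ x : B.Path, ∃ C ∈ Ξ n, x ∈ C := by
      intro x
      have : x ∈ ⋃₀ (↑(Ξ n) : Set (Set B.Path)) := by rw [hcover]; trivial
      obtain ⟨C, hC, hx⟩ := this
      exact ⟨C, hC, hx⟩
    choose C hC hxC using hat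
    have h1 : (Finset.univ.image fun p => C (y p)) ⊆ Ξ n := by
      intro D hD
      obtain ⟨p, -, rfl⟩ := Finset.mem_image.1 hD
      exact hC _
    have h2 : (Finset.univ.image fun p => C (y p)).card ≤ r := by
      refine Finset.card_image_le.trans ?_
      rw [Finset.card_univ, Fintype.card_sigma]
      simp [hβ₀r]
    obtain ⟨S, hS1, hS2, hS3⟩ := Finset.exists_subsuperset_card_eq h1 h2 hcard
    refine Set.mem_iUnion₂.2 ⟨S, Finset.mem_powersetCard.2 ⟨hS2, hS3⟩, fun p => ?_⟩
    exact ⟨C (y p), hS1 (Finset.mem_image_of_mem _ (Finset.mem_univ p)), hxC _⟩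
  have := BratteliDiagram.prodMeasure_prob hprob β₀
  rw [huniv, measure_univ, mul_one]
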